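/- Let d ≥ 2, 1 < p < ∞, and j, k ∈ {1,…,d} with j ≠ k. Suppose M ≥ 0 is such that ‖𝓡^{(jk)} f‖_{ℓ^p(ℤ^d)} ≤ M ‖f‖_{ℓ^p(ℤ^d)} for all f ∈ ℓ^p(ℤ^d). Then for every smooth compactly supported F : ℝ^d → ℝ, ‖R^{(jk)}F‖_{L^p(ℝ^d)} ≤ M ‖F‖_{L^p(ℝ^d)}, where R^{(jk)}F(x) = lim_{r→0⁺} c_d ∫_{|y|>r} y_j y_k |y|^{−(d+2)} F(x−y) dy. Analogously, if M' ≥ 0 satisfies ‖(𝓡^{(jj)} − 𝓡^{(kk)}) f‖_{ℓ^p} ≤ M' ‖f‖_{ℓ^p} for all f ∈ ℓ^p(ℤ^d), then ‖(R^{(jj)} − R^{(kk)})F‖_{L^p(ℝ^d)} ≤ M' ‖F‖_{L^p(ℝ^d)} for every smooth compactly supported F. -/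

import Mathlib

open MeasureTheory Real Filter

noncomputable section

/-- The lattice ℤ^d. -/
abbrev ZLat (d : ℕ) := Fin d → ℤ

/-- Embedding of the lattice ℤ^d into Euclidean space ℝ^d. -/
def latVec {d : ℕ} (m : ZLat d) : EuclideanSpace ℝ (Fin d) := WithLp.toLp 2 (fun i => (m i : ℝ))

/-- The (Gaussian) heat kernel on ℝ^d. -/
def heatK (d : ℕ) (t : ℝ) (x : EuclideanSpace ℝ (Fin d)) : ℝ :=
  (2 * π * t) ^ (-(d : ℝ) / 2) * Real.exp (-‖x‖ ^ 2 / (2 * t))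

/-- The periodic heat kernel H_t(x) = Σ_{n ∈ ℤ^d} P_t(x − n). -/
def pHeatK (d : ℕ) (t : ℝ) (x : EuclideanSpace ℝ (Fin d)) : ℝ :=
  ∑' n : ZLat d, heatK d t (x - latVec n)

/-- Partial derivative in the j-th coordinate direction. -/
def pderiv {d : ℕ} (j : Fin d) (f : EuclideanSpace ℝ (Fin d) → ℝ)
    (x : EuclideanSpace ℝ (Fin d)) : ℝ :=
  fderiv ℝ f x (EuclideanSpace.single j 1)

/-- The constant c_d = π^{-d/2} Γ((d+2)/2). -/
def cConst (d : ℕ) : ℝ := π ^ (-(d : ℝ) / 2) * Real.Gamma (((d : ℝ) + 2) / 2)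

/-- The discrete second-order Riesz kernel K_dis^{(jk)}. -/
def discK (d : ℕ) (j k : Fin d) (m : ZLat d) : ℝ :=
  if m = 0 then 0 else cConst d * (m j : ℝ) * (m k : ℝ) / ‖latVec m‖ ^ (d + 2)

/-- The discrete second-order Riesz transform R_dis^{(jk)}. -/
def Rdis (d : ℕ) (j k : Fin d) (f : ZLat d → ℝ) (n : ZLat d) : ℝ :=
  ∑' m : ZLat d, discK d j k m * f (n - m)

/-- The probabilistic kernel 𝒦^{(jk)}(m). -/
def probK (d : ℕ) (j k : Fin d) (m : ZLat d) : ℝ :=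
  -∫ s in Set.Ioi (0 : ℝ), ∫ x : EuclideanSpace ℝ (Fin d),
      pHeatK d s x *
        (pderiv j (fun y => heatK d s y / pHeatK d s y) x *
         pderiv k (fun y => heatK d s (y - latVec m) / pHeatK d s y) x)

/-- The probabilistic discrete second-order Riesz transform 𝓡^{(jk)}. -/
def Rprob (d : ℕ) (j k : Fin d) (f : ZLat d → ℝ) (n : ZLat d) : ℝ :=
  ∑' m : ZLat d, probK d j k (n - m) * f m

/-- The ℓ^p norm of f : ℤ^d → ℝ. -/
def lpN (d : ℕ) (p : ℝ) (f : ZLat d → ℝ) : ℝ := (∑' n : ZLat d, |f n| ^ p) ^ (1 / p)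

/-- Membership in ℓ^p(ℤ^d). -/
def MemLpLat (d : ℕ) (p : ℝ) (f : ZLat d → ℝ) : Prop := Summable fun n : ZLat d => |f n| ^ p

/-- Operator norm of an operator on ℓ^p(ℤ^d): sup of ‖Tf‖ over ‖f‖ = 1. -/
def opN (d : ℕ) (p : ℝ) (T : (ZLat d → ℝ) → (ZLat d → ℝ)) : ℝ :=
  sSup {c : ℝ | ∃ f : ZLat d → ℝ, MemLpLat d p f ∧ lpN d p f = 1 ∧ c = lpN d p (T f)}

/-- p* = max{p, p/(p-1)}. -/
def pstar (p : ℝ) : ℝ := max p (p / (p - 1))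


abbrev Eu (d : ℕ) := EuclideanSpace ℝ (Fin d)

def flr {d : ℕ} (y : Eu d) : ZLat d := fun i => ⌊y i⌋

lemma flr_meas {d : ℕ} : Measurable (flr : Eu d → ZLat d) := by
  refine measurable_pi_iff.2 fun i => ?_
  exact Int.measurable_floor.comp (by fun_prop)

lemma latVec_meas {d : ℕ} : Measurable (latVec : ZLat d → Eu d) := measurable_of_countable _

lemma flr_mp {d : ℕ} : MeasurePreserving (flr : Eu d → ZLat d) volume Measure.count := by
  refine ⟨flr_meas, ?_⟩
  refine Measure.ext_of_singleton fun n => ?_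
  rw [Measure.map_apply flr_meas (measurableSet_singleton n), Measure.count_singleton]
  have h1 : flr ⁻¹' {n} = (WithLp.ofLp : Eu d → (Fin d → ℝ)) ⁻¹'
      (Set.univ.pi fun i => Set.Ico (n i : ℝ) (n i + 1)) := by
    ext y
    simp [flr, funext_iff, Int.floor_eq_iff]
  rw [h1, (PiLp.volume_preserving_ofLp (Fin d)).measure_preimage
    (MeasurableSet.univ_pi fun i => measurableSet_Ico).nullMeasurableSet, volume_pi_pi]
  simp

lemma summable_iff_flr {d : ℕ} (g : ZLat d → ℝ) :
    Summable g ↔ Integrable (fun y : Eu d => g (flr y)) := by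
  rw [← summable_abs_iff]
  change Summable (fun n => ‖g n‖) ↔ _
  rw [← integrable_count_iff]
  exact (flr_mp.integrable_comp (measurable_of_countable g).aestronglyMeasurable).symm

lemma tsum_eq_flr {d : ℕ} (g : ZLat d → ℝ) :
    ∑' n, g n = ∫ y : Eu d, g (flr y) := by
  by_cases h : Summable g
  · have h2 := (integrable_count_iff (f := g)).2 h.abs
    have h3 := integral_countable h2
    simp only [Measure.real, Measure.count_singleton, ENNReal.toReal_one, one_smul] at h3
    rw [← h3, ← flr_mp.map_eq, integral_map flr_meas.aemeasurable
      (measurable_of_countable g).aestronglyMeasurable]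
  · rw [tsum_eq_zero_of_not_summable h, integral_undef]
    rwa [← summable_iff_flr]

lemma tsum_eq_flr_ennreal {d : ℕ} (g : ZLat d → ENNReal) :
    ∑' n, g n = ∫⁻ y : Eu d, g (flr y) := by
  rw [← lintegral_count, ← flr_mp.map_eq, lintegral_map (measurable_of_countable g) flr_meas]

lemma normsq {d : ℕ} (x : Eu d) : ‖x‖ ^ 2 = ∑ i, x i ^ 2 := by
  rw [EuclideanSpace.norm_sq_eq]; simp

lemma latVec_apply {d : ℕ} (n : ZLat d) (i : Fin d) : latVec n i = n i := rfl

lemma norm_sub_flr {d : ℕ} (y : Eu d) : ‖y - latVec (flr y)‖ ^ 2 ≤ d := by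
  rw [normsq]
  calc ∑ i, (y - latVec (flr y)) i ^ 2 ≤ ∑ i : Fin d, (1:ℝ) := by
        refine Finset.sum_le_sum fun i _ => ?_
        simp only [PiLp.sub_apply, latVec_apply, flr]
        have h1 := Int.floor_le (y i)
        have h2 := Int.lt_floor_add_one (y i)
        nlinarith
    _ = d := by simp

lemma norm_sub_flr' {d : ℕ} (y : Eu d) : ‖y - latVec (flr y)‖ ≤ √d :=
  Real.le_sqrt_of_sq_le (norm_sub_flr y)

/-- scaled version -/
lemma norm_sub_flr_scale {d : ℕ} (N : ℝ) (hN : 0 < N) (y : Eu d) :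
    ‖y - N⁻¹ • latVec (flr (N • y))‖ ≤ √d / N := by
  have : y - N⁻¹ • latVec (flr (N • y)) = N⁻¹ • (N • y - latVec (flr (N • y))) := by
    rw [smul_sub, smul_smul, inv_mul_cancel₀ hN.ne', one_smul]
  rw [this, norm_smul, norm_inv, Real.norm_of_nonneg hN.le, div_eq_inv_mul]
  gcongr
  exact norm_sub_flr' _

lemma flr_scale_tendsto {d : ℕ} (y : Eu d) :
    Tendsto (fun N : ℕ => (N:ℝ)⁻¹ • latVec (flr ((N:ℝ) • y))) atTop (nhds y) := by
  rw [tendsto_iff_norm_sub_tendsto_zero]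
  have h : Tendsto (fun N : ℕ => √d / (N:ℝ)) atTop (nhds 0) :=
    tendsto_const_div_atTop_nhds_zero_nat _
  refine tendsto_of_tendsto_of_tendsto_of_le_of_le' tendsto_const_nhds h
    (Eventually.of_forall fun _ => norm_nonneg _) ?_
  filter_upwards [eventually_gt_atTop 0] with N hN
  rw [norm_sub_rev]
  exact norm_sub_flr_scale _ (by exact_mod_cast hN) y

/-- Scaled sum to integral. -/
lemma tsum_eq_flr_scale {d : ℕ} (g : ZLat d → ℝ) (N : ℝ) (hN : 0 < N) :
    ∑' n, g n = N ^ d * ∫ y : Eu d, g (flr (N • y)) := by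
  have := Measure.integral_comp_smul_of_nonneg volume (fun y : Eu d => g (flr y)) N (hR := hN.le)
  rw [this, tsum_eq_flr]
  simp only [finrank_euclideanSpace, Fintype.card_fin, smul_eq_mul]
  rw [← mul_assoc, mul_inv_cancel₀ (by positivity), one_mul]

lemma latVec_sub {d : ℕ} (m n : ZLat d) : latVec (m - n) = latVec m - latVec n := by
  ext i; simp [latVec_apply]

lemma latVec_zero {d : ℕ} : latVec (0 : ZLat d) = 0 := by
  ext i; simp [latVec_apply]

lemma one_le_norm_latVec {d : ℕ} (m : ZLat d) (hm : m ≠ 0) : 1 ≤ ‖latVec m‖ := by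
  obtain ⟨i, hi⟩ := Function.ne_iff.1 hm
  have h1 : (1:ℝ) ≤ |(m i : ℝ)| := by
    have : (1:ℤ) ≤ |m i| := Int.one_le_abs (by simpa using hi)
    exact_mod_cast this
  have h2 := PiLp.norm_apply_le (latVec m) i
  rw [latVec_apply, Real.norm_eq_abs] at h2
  linarith

lemma gauss_int {d : ℕ} {b : ℝ} (hb : 0 < b) : Integrable (fun x : Eu d => exp (-b * ‖x‖ ^ 2)) := by
  have := (GaussianFourier.integrable_cexp_neg_mul_sq_norm_add (V := Eu d) (b := (b:ℂ))
    (by simpa using hb) 0 0).norm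
  refine this.congr (Eventually.of_forall fun x => ?_)
  simp only [Complex.norm_exp]
  congr 1
  simp [← Complex.ofReal_pow]

lemma gauss_val {d : ℕ} {b : ℝ} (hb : 0 < b) :
    ∫ x : Eu d, exp (-b * ‖x‖ ^ 2) = (π / b) ^ ((d:ℝ) / 2) := by
  have := GaussianFourier.integral_rexp_neg_mul_sq_norm (V := Eu d) hb
  simpa using this

lemma heatK_pos {d : ℕ} {t : ℝ} (ht : 0 < t) (x : Eu d) : 0 < heatK d t x := by
  unfold heatK; positivity

lemma heatK_cont {d : ℕ} (t : ℝ) : Continuous (heatK d t) := by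
  unfold heatK; fun_prop

lemma heatK_neg {d : ℕ} (t : ℝ) (x : Eu d) : heatK d t (-x) = heatK d t x := by
  simp [heatK]

lemma heatK_int {d : ℕ} {t : ℝ} (ht : 0 < t) : Integrable (heatK d t) := by
  unfold heatK
  refine Integrable.const_mul ?_ _
  have := gauss_int (d := d) (b := 1 / (2 * t)) (by positivity)
  refine this.congr (Eventually.of_forall fun x => ?_)
  simp only; congr 1; field_simp

lemma heatK_val {d : ℕ} {t : ℝ} (ht : 0 < t) : ∫ x, heatK d t x = 1 := by
  unfold heatK
  rw [integral_const_mul]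
  have := gauss_val (d := d) (b := 1 / (2 * t)) (by positivity)
  have h2 : ∀ x : Eu d, exp (-‖x‖ ^ 2 / (2 * t)) = exp (-(1 / (2 * t)) * ‖x‖ ^ 2) := by
    intro x; congr 1; field_simp
  simp_rw [h2]
  rw [this]
  have : π / (1 / (2 * t)) = 2 * π * t := by field_simp
  rw [this, ← Real.rpow_add (by positivity)]
  simp [neg_div]

lemma heatK_scale {d : ℕ} {t l : ℝ} (ht : 0 < t) (hl : 0 < l) (u : Eu d) :
    heatK d (l ^ 2 * t) (l • u) = (l ^ d)⁻¹ * heatK d t u := by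
  unfold heatK
  rw [norm_smul, Real.norm_of_nonneg hl.le]
  have h1 : (2 * π * (l ^ 2 * t)) ^ (-(d:ℝ) / 2) = (l ^ d)⁻¹ * (2 * π * t) ^ (-(d:ℝ) / 2) := by
    rw [show 2 * π * (l ^ 2 * t) = l ^ 2 * (2 * π * t) by ring, Real.mul_rpow (by positivity) (by positivity)]
    congr 1
    rw [← Real.rpow_natCast l 2, ← Real.rpow_mul hl.le, ← Real.rpow_natCast, ← Real.rpow_neg hl.le]
    congr 1; push_cast; ring
  rw [h1, mul_assoc]
  congr 3
  field_simp

lemma heatK_double {d : ℕ} {t : ℝ} (ht : 0 < t) (c : ℝ) (hc : 0 < c) (z : Eu d) :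
    (2 * π * t) ^ (-(d:ℝ) / 2) * exp (-‖z‖ ^ 2 / (2 * (c * t))) = c ^ ((d:ℝ) / 2) * heatK d (c * t) z := by
  unfold heatK
  rw [show 2 * π * (c * t) = c * (2 * π * t) by ring, Real.mul_rpow hc.le (by positivity)]
  have h : c ^ ((d:ℝ) / 2) * c ^ (-(d:ℝ) / 2) = 1 := by
    rw [← Real.rpow_add hc]; simp [neg_div]
  linear_combination (-(2 * π * t) ^ (-(d:ℝ) / 2) * exp (-‖z‖ ^ 2 / (2 * (c * t)))) * h

lemma normsq_le_two {d : ℕ} {D : ℝ} (w z : Eu d) (h : ‖w - z‖ ^ 2 ≤ D) :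
    ‖w‖ ^ 2 ≤ 2 * ‖z‖ ^ 2 + 2 * D := by
  have h1 : ‖w‖ ≤ ‖w - z‖ + ‖z‖ := by simpa using norm_add_le (w - z) z
  nlinarith [norm_nonneg w, norm_nonneg z, norm_nonneg (w - z), sq_nonneg (‖w - z‖ - ‖z‖)]

lemma heatK_le_near {d : ℕ} {t D : ℝ} (ht : 0 < t) (w z : Eu d) (h : ‖w - z‖ ^ 2 ≤ D) :
    heatK d t w ≤ exp (D / (2 * t)) * 2 ^ ((d:ℝ) / 2) * heatK d (2 * t) z := by
  rw [mul_assoc, ← heatK_double ht 2 two_pos, mul_left_comm, ← Real.exp_add]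
  unfold heatK
  gcongr
  have := normsq_le_two (D := D) z w (by rwa [norm_sub_rev])
  rw [← sub_nonneg]
  have : D / (2 * t) + -‖z‖ ^ 2 / (2 * (2 * t)) - -‖w‖ ^ 2 / (2 * t)
     = (2 * ‖w‖ ^ 2 + 2 * D - ‖z‖ ^ 2) / (4 * t) := by field_simp; ring
  rw [this]
  apply div_nonneg <;> linarith

lemma heatK_ge_near {d : ℕ} {t D : ℝ} (ht : 0 < t) (w z : Eu d) (h : ‖w - z‖ ^ 2 ≤ D) :
    exp (-D / t) * 2⁻¹ ^ ((d:ℝ) / 2) * heatK d (2⁻¹ * t) z ≤ heatK d t w := by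
  rw [mul_assoc, ← heatK_double ht 2⁻¹ (by norm_num), mul_left_comm, ← Real.exp_add]
  unfold heatK
  gcongr
  have := normsq_le_two w z h
  rw [← sub_nonneg]
  have : -‖w‖ ^ 2 / (2 * t) - (-D / t + -‖z‖ ^ 2 / (2 * (2⁻¹ * t)))
     = (2 * ‖z‖ ^ 2 + 2 * D - ‖w‖ ^ 2) / (2 * t) := by field_simp; ring
  rw [this]
  apply div_nonneg <;> linarith

lemma mul_exp_le (r : ℝ) : r * exp (-(2 * r ^ 2)) ≤ exp (-r ^ 2) := by
  have h1 : r ≤ exp (r ^ 2) := by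
    have := Real.add_one_le_exp (r ^ 2)
    nlinarith [sq_nonneg (r - 1/2)]
  calc r * exp (-(2 * r ^ 2)) ≤ exp (r ^ 2) * exp (-(2 * r ^ 2)) := by gcongr
    _ = _ := by rw [← Real.exp_add]; congr 1; ring

lemma norm_mul_heatK {d : ℕ} {t : ℝ} (ht : 0 < t) (z : Eu d) :
    ‖z‖ * heatK d t z ≤ 2 * √t * (2 ^ ((d:ℝ) / 2) * heatK d (2 * t) z) := by
  rw [← heatK_double ht 2 two_pos]
  unfold heatK
  have hs : 0 < √t := Real.sqrt_pos.2 ht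
  have hs2 : √t ^ 2 = t := Real.sq_sqrt ht.le
  have h := mul_exp_le (‖z‖ / (2 * √t))
  have e1 : -(2 * (‖z‖ / (2 * √t)) ^ 2) = -‖z‖ ^ 2 / (2 * t) := by
    rw [div_pow, mul_pow, hs2]; field_simp
  have e2 : -(‖z‖ / (2 * √t)) ^ 2 = -‖z‖ ^ 2 / (2 * (2 * t)) := by
    rw [div_pow, mul_pow, hs2]; field_simp
  rw [e1, e2, div_mul_eq_mul_div, div_le_iff₀ (by positivity)] at h
  calc ‖z‖ * ((2 * π * t) ^ (-(d:ℝ) / 2) * exp (-‖z‖ ^ 2 / (2 * t)))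
      = (2 * π * t) ^ (-(d:ℝ) / 2) * (‖z‖ * exp (-‖z‖ ^ 2 / (2 * t))) := by ring
    _ ≤ (2 * π * t) ^ (-(d:ℝ) / 2) * (exp (-‖z‖ ^ 2 / (2 * (2 * t))) * (2 * √t)) := by gcongr
    _ = _ := by ring

lemma heatK_int_sub {d : ℕ} {t : ℝ} (ht : 0 < t) (x : Eu d) : Integrable (fun y => heatK d t (x - y)) :=
  (integrable_comp_sub_left (heatK d t) x).2 (heatK_int ht)

lemma heatK_val_sub {d : ℕ} {t : ℝ} (ht : 0 < t) (x : Eu d) : ∫ y, heatK d t (x - y) = 1 := by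
  rw [integral_sub_left_eq_self (heatK d t), heatK_val ht]

lemma flr_dist {d : ℕ} (x y : Eu d) : ‖(x - latVec (flr y)) - (x - y)‖ ^ 2 ≤ d := by
  have := norm_sub_flr y
  rwa [show (x - latVec (flr y)) - (x - y) = y - latVec (flr y) by abel]

lemma heatK_flr_int {d : ℕ} {t : ℝ} (ht : 0 < t) (x : Eu d) :
    Integrable (fun y => heatK d t (x - latVec (flr y))) := by
  refine Integrable.mono' ((heatK_int_sub (t := 2 * t) (by positivity) x).const_mul
    (exp (d / (2 * t)) * 2 ^ ((d:ℝ) / 2))) ?_ ?_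
  · exact ((heatK_cont t).measurable.comp
      (measurable_const.sub (latVec_meas.comp flr_meas))).aestronglyMeasurable
  · refine Eventually.of_forall fun y => ?_
    rw [Real.norm_of_nonneg (heatK_pos ht _).le]
    exact heatK_le_near ht _ _ (flr_dist x y)

lemma heatK_summable {d : ℕ} {t : ℝ} (ht : 0 < t) (x : Eu d) :
    Summable (fun n : ZLat d => heatK d t (x - latVec n)) :=
  (summable_iff_flr _).2 (heatK_flr_int ht x)

lemma pHeatK_eq {d : ℕ} (t : ℝ) (x : Eu d) :
    pHeatK d t x = ∫ y : Eu d, heatK d t (x - latVec (flr y)) :=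
  tsum_eq_flr _

lemma pHeatK_ge_term {d : ℕ} {t : ℝ} (ht : 0 < t) (x : Eu d) (n : ZLat d) :
    heatK d t (x - latVec n) ≤ pHeatK d t x :=
  (heatK_summable ht x).le_tsum n (fun _ _ => (heatK_pos ht _).le)

lemma pHeatK_pos {d : ℕ} {t : ℝ} (ht : 0 < t) (x : Eu d) : 0 < pHeatK d t x :=
  (heatK_pos ht _).trans_le (pHeatK_ge_term ht x 0)

lemma pHeatK_le {d : ℕ} {t : ℝ} (ht : 0 < t) (x : Eu d) :
    pHeatK d t x ≤ exp (d / (2 * t)) * 2 ^ ((d:ℝ) / 2) := by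
  rw [pHeatK_eq]
  calc _ ≤ ∫ y : Eu d, exp (d / (2 * t)) * 2 ^ ((d:ℝ) / 2) * heatK d (2 * t) (x - y) :=
        integral_mono (heatK_flr_int ht x) ((heatK_int_sub (by positivity) x).const_mul _)
          fun y => heatK_le_near ht _ _ (flr_dist x y)
    _ = _ := by rw [integral_const_mul, heatK_val_sub (by positivity), mul_one]

lemma pHeatK_ge {d : ℕ} {t : ℝ} (ht : 0 < t) (x : Eu d) :
    exp (-d / t) * 2⁻¹ ^ ((d:ℝ) / 2) ≤ pHeatK d t x := by
  rw [pHeatK_eq]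
  calc _ = ∫ y : Eu d, exp (-d / t) * 2⁻¹ ^ ((d:ℝ) / 2) * heatK d (2⁻¹ * t) (x - y) := by
          rw [integral_const_mul, heatK_val_sub (by positivity), mul_one]
    _ ≤ _ := integral_mono ((heatK_int_sub (by positivity) x).const_mul _) (heatK_flr_int ht x)
          fun y => heatK_ge_near ht _ _ (flr_dist x y)

/-- First absolute moment sum. -/
def mom (d : ℕ) (t : ℝ) (x : Eu d) : ℝ := ∑' n : ZLat d, ‖x - latVec n‖ * heatK d t (x - latVec n)

lemma mom_summable {d : ℕ} {t : ℝ} (ht : 0 < t) (x : Eu d) :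
    Summable (fun n : ZLat d => ‖x - latVec n‖ * heatK d t (x - latVec n)) := by
  refine Summable.of_nonneg_of_le (fun n => mul_nonneg (norm_nonneg _) (heatK_pos ht _).le)
    (fun n => norm_mul_heatK ht _) ?_
  exact ((heatK_summable (by positivity) x).mul_left _).mul_left _

lemma mom_le {d : ℕ} {t : ℝ} (ht : 0 < t) (x : Eu d) :
    mom d t x ≤ 2 * √t * (2 ^ ((d:ℝ) / 2) * pHeatK d (2 * t) x) := by
  unfold mom pHeatK
  rw [← tsum_mul_left, ← tsum_mul_left]
  exact (mom_summable ht x).tsum_le_tsum (fun n => norm_mul_heatK ht _)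
    (((heatK_summable (by positivity) x).mul_left _).mul_left _)

/-- Signed first moment. -/
def bmom (d : ℕ) (j : Fin d) (t : ℝ) (x : Eu d) : ℝ :=
  ∑' n : ZLat d, (n j - x j) * heatK d t (x - latVec n)

lemma coord_le {d : ℕ} (x : Eu d) (n : ZLat d) (j : Fin d) : |(n j - x j : ℝ)| ≤ ‖x - latVec n‖ := by
  have := PiLp.norm_apply_le (x - latVec n) j
  rw [PiLp.sub_apply, latVec_apply, Real.norm_eq_abs, abs_sub_comm] at this
  exact this

lemma bmom_term_le {d : ℕ} {t : ℝ} (ht : 0 < t) (x : Eu d) (n : ZLat d) (j : Fin d) :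
    ‖(n j - x j : ℝ) * heatK d t (x - latVec n)‖ ≤ ‖x - latVec n‖ * heatK d t (x - latVec n) := by
  rw [norm_mul, Real.norm_of_nonneg (heatK_pos ht _).le]
  gcongr
  · exact (heatK_pos ht _).le
  · exact coord_le x n j

lemma bmom_summable {d : ℕ} {t : ℝ} (ht : 0 < t) (x : Eu d) (j : Fin d) :
    Summable (fun n : ZLat d => (n j - x j : ℝ) * heatK d t (x - latVec n)) :=
  Summable.of_norm_bounded (mom_summable ht x) fun n => bmom_term_le ht x n j

lemma bmom_le {d : ℕ} {t : ℝ} (ht : 0 < t) (x : Eu d) (j : Fin d) :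
    |bmom d j t x| ≤ mom d t x :=
  tsum_of_norm_bounded (mom_summable ht x).hasSum fun n => bmom_term_le ht x n j

def rnd {d : ℕ} (x : Eu d) : ZLat d := fun i => round (x i)

lemma rnd_min {d : ℕ} (x : Eu d) (n : ZLat d) : ‖x - latVec (rnd x)‖ ^ 2 ≤ ‖x - latVec n‖ ^ 2 := by
  rw [normsq, normsq]
  refine Finset.sum_le_sum fun i _ => ?_
  simp only [PiLp.sub_apply, latVec_apply, rnd]
  exact sq_le_sq.2 (round_le _ _)

lemma rnd_le {d : ℕ} (x : Eu d) : ‖x - latVec (rnd x)‖ ^ 2 ≤ d :=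
  (rnd_min x (flr x)).trans (norm_sub_flr x)

lemma quad_low (x : ℝ) (n : ℤ) :
    (x ^ 2 + (n:ℝ) ^ 2) / 8 ≤ x ^ 2 + (x - n) ^ 2 - (x - round x) ^ 2 := by
  by_cases hn : n = 0
  · subst hn
    have := sq_le_sq.2 (round_le x 0)
    simp at this ⊢
    nlinarith [sq_nonneg x]
  · have h1 : (1:ℝ) ≤ (n:ℝ) ^ 2 := by
      have : (1:ℤ) ≤ n ^ 2 := by have := sq_pos_of_ne_zero hn; omega
      exact_mod_cast this
    have h2 : (x - round x) ^ 2 ≤ 1 / 4 := by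
      have := abs_sub_round x
      rw [← sq_abs]; nlinarith [abs_nonneg (x - round x)]
    nlinarith [sq_nonneg (x - n / 2), sq_nonneg (7 * x - 4 * n)]

lemma quad_low_vec {d : ℕ} (x : Eu d) (m : ZLat d) :
    (‖x‖ ^ 2 + ‖latVec m‖ ^ 2) / 8 ≤ ‖x‖ ^ 2 + ‖x - latVec m‖ ^ 2 - ‖x - latVec (rnd x)‖ ^ 2 := by
  simp only [normsq, ← Finset.sum_add_distrib, ← Finset.sum_sub_distrib, Finset.sum_div]
  refine Finset.sum_le_sum fun i _ => ?_
  simp only [PiLp.sub_apply, latVec_apply, rnd]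
  exact quad_low (x i) (m i)

lemma pHeatK_ge_one {d : ℕ} {s : ℝ} (hs : 1 ≤ s) (x : Eu d) :
    exp (-d) * 2⁻¹ ^ ((d:ℝ) / 2) ≤ pHeatK d s x := by
  refine le_trans ?_ (pHeatK_ge (by linarith) x)
  gcongr
  rw [neg_div, neg_le_neg_iff]
  exact div_le_self (by positivity) hs

lemma pHeatK_le_one {d : ℕ} {s : ℝ} (hs : 1 ≤ s) (x : Eu d) :
    pHeatK d s x ≤ exp d * 2 ^ ((d:ℝ) / 2) := by
  refine (pHeatK_le (by linarith) x).trans ?_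
  gcongr
  exact div_le_self (by positivity) (by linarith)

lemma mom_le_one {d : ℕ} {s : ℝ} (hs : 1 ≤ s) (x : Eu d) :
    mom d s x ≤ 2 * √s * (2 ^ ((d:ℝ) / 2) * (exp d * 2 ^ ((d:ℝ) / 2))) := by
  refine (mom_le (by linarith) x).trans ?_
  gcongr
  exact pHeatK_le_one (by linarith) x

lemma heatK_one_rnd {d : ℕ} (x : Eu d) :
    (2 * π * 1) ^ (-(d:ℝ) / 2) * exp (-d / 2) ≤ heatK d 1 (x - latVec (rnd x)) := by
  unfold heatK
  refine mul_le_mul_of_nonneg_left (Real.exp_le_exp.2 ?_) (by positivity)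
  have := rnd_le x
  rw [mul_one]
  linarith

lemma mom_small {d : ℕ} {s : ℝ} (hs : 0 < s) (hs1 : s ≤ 1) (x : Eu d) :
    mom d s x * heatK d 1 (x - latVec (rnd x)) ≤ mom d 1 x * heatK d s (x - latVec (rnd x)) := by
  unfold mom
  rw [← tsum_mul_right, ← tsum_mul_right]
  refine ((mom_summable hs x).mul_right _).tsum_le_tsum (fun n => ?_)
    ((mom_summable one_pos x).mul_right _)
  rw [mul_assoc, mul_assoc]
  gcongr ?_ * ?_
  unfold heatK
  have h := rnd_min x n
  set r := ‖x - latVec (rnd x)‖ ^ 2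
  set z := ‖x - latVec n‖ ^ 2
  have : exp (-z / (2 * s)) * exp (-r / (2 * 1)) ≤ exp (-z / (2 * 1)) * exp (-r / (2 * s)) := by
    rw [← Real.exp_add, ← Real.exp_add]
    refine Real.exp_le_exp.2 ?_
    rw [← sub_nonneg]
    have : -z / (2 * 1) + -r / (2 * s) - (-z / (2 * s) + -r / (2 * 1)) =
      (z - r) * (1 - s) / (2 * s) := by field_simp; ring
    rw [this]
    have := sub_nonneg.2 h
    have := sub_nonneg.2 hs1
    positivity
  calc _ = ((2 * π * s) ^ (-(d:ℝ) / 2) * (2 * π * 1) ^ (-(d:ℝ) / 2)) * (exp (-z / (2 * s)) * exp (-r / (2 * 1))) := by ring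
    _ ≤ ((2 * π * s) ^ (-(d:ℝ) / 2) * (2 * π * 1) ^ (-(d:ℝ) / 2)) * (exp (-z / (2 * 1)) * exp (-r / (2 * s))) := by gcongr
    _ = _ := by ring

lemma b2 (d : ℕ) : ∃ C : ℝ, 0 ≤ C ∧ ∀ s : ℝ, 0 < s → ∀ x : Eu d, ∀ j : Fin d,
    |bmom d j s x / pHeatK d s x| ≤ C * (1 + √s) := by
  set C1 : ℝ := 2 * (2 ^ ((d:ℝ) / 2) * (exp d * 2 ^ ((d:ℝ) / 2))) with hC1
  set c : ℝ := exp (-d) * 2⁻¹ ^ ((d:ℝ) / 2) with hc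
  set c0 : ℝ := (2 * π * 1) ^ (-(d:ℝ) / 2) * exp (-d / 2) with hc0
  have hC1p : 0 < C1 := by positivity
  have hcp : 0 < c := by positivity
  have hc0p : 0 < c0 := by positivity
  refine ⟨C1 / c + C1 / c0, by positivity, fun s hs x j => ?_⟩
  have hH := pHeatK_pos hs x
  rw [abs_div, abs_of_pos hH, div_le_iff₀ hH]
  refine (bmom_le hs x j).trans ?_
  have hsq := Real.sqrt_nonneg s
  rcases le_total 1 s with h | h
  · calc mom d s x ≤ √s * C1 := (mom_le_one h x).trans (le_of_eq (by ring))
      _ = C1 / c * √s * c := by field_simp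
      _ ≤ (C1 / c + C1 / c0) * (1 + √s) * pHeatK d s x := by
        gcongr
        · have : 0 ≤ C1 / c0 := by positivity
          linarith
        · linarith
        · exact pHeatK_ge_one h x
  · have h1 := mom_small hs h x
    have h2 : mom d 1 x ≤ C1 := (mom_le_one le_rfl x).trans (le_of_eq (by simp [hC1]))
    have h3 := heatK_one_rnd x
    have h4 := pHeatK_ge_term hs x (rnd x)
    have hm : 0 ≤ mom d s x := tsum_nonneg fun n => mul_nonneg (norm_nonneg _) (heatK_pos hs _).le
    have h5 : mom d s x * c0 ≤ C1 * pHeatK d s x := by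
      calc mom d s x * c0 ≤ mom d s x * heatK d 1 (x - latVec (rnd x)) := by gcongr
        _ ≤ _ := h1
        _ ≤ C1 * pHeatK d s x := by
          gcongr
          exact (heatK_pos hs _).le
    calc mom d s x ≤ C1 * pHeatK d s x / c0 := by rwa [le_div_iff₀ hc0p]
      _ = C1 / c0 * 1 * pHeatK d s x := by ring
      _ ≤ (C1 / c + C1 / c0) * (1 + √s) * pHeatK d s x := by
        gcongr
        · have : 0 ≤ C1 / c := by positivity
          linarith
        · linarith

lemma b1 (d : ℕ) : ∃ C : ℝ, 0 ≤ C ∧ ∀ s : ℝ, 0 < s → ∀ x : Eu d, ∀ m : ZLat d,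
    heatK d s x * heatK d s (x - latVec m) / pHeatK d s x ≤
      C * ((s ^ d)⁻¹ * exp (-(‖x‖ ^ 2 + ‖latVec m‖ ^ 2) / (16 * s))) := by
  set c : ℝ := exp (-d) * 2⁻¹ ^ ((d:ℝ) / 2) with hc
  have hcp : 0 < c := by positivity
  refine ⟨1 + c⁻¹, by positivity, fun s hs x m => ?_⟩
  have hH := pHeatK_pos hs x
  have hq := quad_low_vec x m
  have hpi : 1 ≤ 2 * π := by linarith [Real.pi_gt_three]
  rcases le_total 1 s with h | h
  · have h1 := pHeatK_ge_one h x
    rw [div_le_iff₀ hH]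
    have e1 : heatK d s x * heatK d s (x - latVec m) =
        ((2 * π * s) ^ d)⁻¹ * exp (-(‖x‖ ^ 2 + ‖x - latVec m‖ ^ 2) / (2 * s)) := by
      unfold heatK
      have : (2 * π * s) ^ (-(d:ℝ) / 2) * (2 * π * s) ^ (-(d:ℝ) / 2) = ((2 * π * s) ^ d)⁻¹ := by
        rw [← Real.rpow_add (by positivity), ← Real.rpow_natCast, ← Real.rpow_neg (by positivity)]
        congr 1; ring
      rw [← this, neg_add, add_div, Real.exp_add]; ring
    have e2 : ((2 * π * s) ^ d)⁻¹ ≤ (s ^ d)⁻¹ := by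
      gcongr
      nlinarith
    have e3 : exp (-(‖x‖ ^ 2 + ‖x - latVec m‖ ^ 2) / (2 * s)) ≤ exp (-(‖x‖ ^ 2 + ‖latVec m‖ ^ 2) / (16 * s)) := by
      refine Real.exp_le_exp.2 ?_
      rw [div_le_div_iff₀ (by positivity) (by positivity)]
      nlinarith [sq_nonneg ‖x - latVec (rnd x)‖]
    rw [e1]
    calc _ ≤ (s ^ d)⁻¹ * exp (-(‖x‖ ^ 2 + ‖latVec m‖ ^ 2) / (16 * s)) := by gcongr
      _ = c⁻¹ * ((s ^ d)⁻¹ * exp (-(‖x‖ ^ 2 + ‖latVec m‖ ^ 2) / (16 * s))) * c := by field_simp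
      _ ≤ _ := by
        gcongr
        linarith
  · have h4 := pHeatK_ge_term hs x (rnd x)
    have hp := heatK_pos (d := d) hs
    have e0 : (2 * π * s) ^ (-(d:ℝ) / 2) ≤ (s ^ d)⁻¹ := by
      calc (2 * π * s) ^ (-(d:ℝ) / 2) ≤ s ^ (-(d:ℝ) / 2) := by
            apply Real.rpow_le_rpow_of_nonpos hs (by nlinarith)
            rw [neg_div]; simp; positivity
        _ ≤ s ^ (-(d:ℝ)) := by
            apply Real.rpow_le_rpow_of_exponent_ge hs h
            have : (0:ℝ) ≤ d := by positivity
            linarith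
        _ = _ := by rw [Real.rpow_neg hs.le, Real.rpow_natCast]
    have e1 : heatK d s x * heatK d s (x - latVec m) ≤ ((s ^ d)⁻¹ * exp (-(‖x‖ ^ 2 + ‖latVec m‖ ^ 2) / (16 * s))) *
        heatK d s (x - latVec (rnd x)) := by
      unfold heatK
      have : exp (-‖x‖ ^ 2 / (2 * s)) * exp (-‖x - latVec m‖ ^ 2 / (2 * s)) ≤
          exp (-(‖x‖ ^ 2 + ‖latVec m‖ ^ 2) / (16 * s)) * exp (-‖x - latVec (rnd x)‖ ^ 2 / (2 * s)) := by
        rw [← Real.exp_add, ← Real.exp_add]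
        refine Real.exp_le_exp.2 ?_
        rw [← sub_nonneg]
        have : -(‖x‖ ^ 2 + ‖latVec m‖ ^ 2) / (16 * s) + -‖x - latVec (rnd x)‖ ^ 2 / (2 * s) -
          (-‖x‖ ^ 2 / (2 * s) + -‖x - latVec m‖ ^ 2 / (2 * s)) =
          (‖x‖ ^ 2 + ‖x - latVec m‖ ^ 2 - ‖x - latVec (rnd x)‖ ^ 2 - (‖x‖ ^ 2 + ‖latVec m‖ ^ 2) / 8) / (2 * s) := by
          field_simp; ring
        rw [this]
        have := sub_nonneg.2 hq
        positivity
      set A := (2 * π * s) ^ (-(d:ℝ) / 2)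
      have hA : 0 ≤ A := by positivity
      calc _ = A * A * (exp (-‖x‖ ^ 2 / (2 * s)) * exp (-‖x - latVec m‖ ^ 2 / (2 * s))) := by ring
        _ ≤ (s ^ d)⁻¹ * A * (exp (-(‖x‖ ^ 2 + ‖latVec m‖ ^ 2) / (16 * s)) * exp (-‖x - latVec (rnd x)‖ ^ 2 / (2 * s))) := by gcongr
        _ = _ := by ring
    rw [div_le_iff₀ hH]
    refine e1.trans ?_
    have : 0 ≤ c⁻¹ := by positivity
    calc _ ≤ ((s ^ d)⁻¹ * exp (-(‖x‖ ^ 2 + ‖latVec m‖ ^ 2) / (16 * s))) * pHeatK d s x := by gcongr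
      _ = 1 * ((s ^ d)⁻¹ * exp (-(‖x‖ ^ 2 + ‖latVec m‖ ^ 2) / (16 * s))) * pHeatK d s x := by ring
      _ ≤ _ := by gcongr; linarith

def heatD {d : ℕ} (s : ℝ) (z : Eu d) : Eu d →L[ℝ] ℝ := (-(heatK d s z / s)) • innerSL ℝ z

lemma heatK_hasFDerivAt {d : ℕ} {s : ℝ} (hs : 0 < s) (x v : Eu d) :
    HasFDerivAt (fun y => heatK d s (y - v)) (heatD s (x - v)) x := by
  have h1 : HasFDerivAt (fun y : Eu d => ‖y - v‖ ^ 2) (2 • innerSL ℝ (x - v)) x := by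
    have := ((hasFDerivAt_id x).sub_const v).norm_sq
    simpa using this
  have h2 := ((h1.neg.mul_const (2 * s)⁻¹).exp).const_mul ((2 * π * s) ^ (-(d:ℝ) / 2))
  refine (h2.congr_fderiv ?_).congr_of_eventuallyEq ?_
  · ext w
    simp [heatD, heatK, div_eq_mul_inv]
    field_simp
  · refine Eventually.of_forall fun y => ?_
    simp [heatK, div_eq_mul_inv]

lemma heatD_norm {d : ℕ} {s : ℝ} (hs : 0 < s) (z : Eu d) :
    ‖heatD s z‖ ≤ s⁻¹ * (‖z‖ * heatK d s z) := by
  unfold heatD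
  rw [norm_smul, innerSL_apply_norm, norm_neg, Real.norm_of_nonneg (div_nonneg (heatK_pos hs z).le hs.le)]
  apply le_of_eq; ring

lemma heatD_apply {d : ℕ} {s : ℝ} (z : Eu d) (j : Fin d) :
    heatD s z (EuclideanSpace.single j 1) = -(z j) * heatK d s z / s := by
  simp [heatD, EuclideanSpace.inner_single_right]
  ring

lemma heatD_summable_bound {d : ℕ} {s : ℝ} (hs : 0 < s) (x : Eu d) :
    ∃ u : ZLat d → ℝ, Summable u ∧ ∀ n, ∀ y ∈ Metric.ball x 1, ‖heatD s (y - latVec n)‖ ≤ u n := by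
  refine ⟨fun n => s⁻¹ * (2 * √s * (2 ^ ((d:ℝ) / 2) *
    (exp (1 / (2 * (2 * s))) * 2 ^ ((d:ℝ) / 2) * heatK d (2 * (2 * s)) (x - latVec n)))), ?_, ?_⟩
  · exact ((((heatK_summable (by positivity) x).mul_left _).mul_left _).mul_left _).mul_left _
  · intro n y hy
    refine (heatD_norm hs _).trans ?_
    refine mul_le_mul_of_nonneg_left ?_ (by positivity)
    refine (norm_mul_heatK hs _).trans ?_
    gcongr
    refine heatK_le_near (by positivity) _ _ ?_
    rw [show y - latVec n - (x - latVec n) = y - x by abel]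
    have : ‖y - x‖ < 1 := by simpa [dist_eq_norm] using hy
    nlinarith [norm_nonneg (y - x)]

lemma pHeatK_hasFDerivAt {d : ℕ} {s : ℝ} (hs : 0 < s) (x : Eu d) :
    HasFDerivAt (pHeatK d s) (∑' n : ZLat d, heatD s (x - latVec n)) x := by
  obtain ⟨u, hu, hb⟩ := heatD_summable_bound hs x
  exact hasFDerivAt_tsum_of_isPreconnected hu Metric.isOpen_ball
    (convex_ball x 1).isPreconnected (fun n y _ => heatK_hasFDerivAt hs y (latVec n)) hb
    (Metric.mem_ball_self one_pos) (heatK_summable hs x) (Metric.mem_ball_self one_pos)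

lemma pHeatK_deriv_apply {d : ℕ} {s : ℝ} (hs : 0 < s) (x : Eu d) (j : Fin d) :
    (∑' n : ZLat d, heatD s (x - latVec n)) (EuclideanSpace.single j 1) = bmom d j s x / s := by
  obtain ⟨u, hu, hb⟩ := heatD_summable_bound hs x
  have hsum : Summable fun n : ZLat d => heatD s (x - latVec n) :=
    Summable.of_norm_bounded hu fun n => hb n x (Metric.mem_ball_self one_pos)
  have := (ContinuousLinearMap.apply ℝ ℝ (EuclideanSpace.single j (1:ℝ) : Eu d)).map_tsum hsum
  simp only [ContinuousLinearMap.apply_apply] at this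
  rw [this]
  unfold bmom
  rw [← tsum_div_const]
  congr 1; ext n
  rw [heatD_apply]
  simp [latVec_apply]

lemma pderiv_quot {d : ℕ} {s : ℝ} (hs : 0 < s) (x v : Eu d) (j : Fin d) :
    pderiv j (fun y => heatK d s (y - v) / pHeatK d s y) x =
      heatK d s (x - v) / (s * pHeatK d s x) * (v j - x j - bmom d j s x / pHeatK d s x) := by
  have hH := (pHeatK_pos hs x).ne'
  have h0 := (hasDerivAt_inv hH).comp_hasFDerivAt x (pHeatK_hasFDerivAt hs x)
  have h := (heatK_hasFDerivAt hs x v).mul h0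
  unfold pderiv
  change fderiv ℝ ((fun y => heatK d s (y - v)) * ((fun y => y⁻¹) ∘ pHeatK d s)) x _ = _
  rw [h.fderiv]
  simp only [smul_apply, add_apply, smul_eq_mul,
    Function.comp_apply,
    heatD_apply, pHeatK_deriv_apply hs, PiLp.sub_apply]
  field_simp
  ring

/-- The integrand. -/
def Jf (d : ℕ) (j k : Fin d) (v : Eu d) (s : ℝ) (x : Eu d) : ℝ :=
  heatK d s x * heatK d s (x - v) / pHeatK d s x *
    ((x j + bmom d j s x / pHeatK d s x) * (v k - x k - bmom d k s x / pHeatK d s x))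

lemma probK_eq {d : ℕ} (j k : Fin d) (m : ZLat d) :
    probK d j k m = ∫ s in Set.Ioi (0:ℝ), (s ^ 2)⁻¹ * ∫ x, Jf d j k (latVec m) s x := by
  unfold probK
  rw [← integral_neg]
  refine setIntegral_congr_fun measurableSet_Ioi fun s hs => ?_
  have hs : 0 < s := hs
  beta_reduce
  rw [← integral_neg, ← integral_const_mul]
  congr 1; ext x
  have h0 := pderiv_quot hs x 0 j
  simp only [sub_zero] at h0
  rw [h0, pderiv_quot hs x (latVec m) k]
  have hH := (pHeatK_pos hs x).ne'
  unfold Jf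
  simp only [PiLp.zero_apply]
  field_simp
  ring

lemma probK_scale {d : ℕ} (j k : Fin d) (m : ZLat d) {l : ℝ} (hl : 0 < l) :
    l ^ d * probK d j k m = ∫ t in Set.Ioi (0:ℝ), (t ^ 2)⁻¹ *
      ∫ u : Eu d, l ^ (2 * d) * (l ^ 2)⁻¹ * Jf d j k (latVec m) (l ^ 2 * t) (l • u) := by
  have hl2 : (0:ℝ) < l ^ 2 := by positivity
  have h1 := integral_comp_mul_left_Ioi
    (fun s => (s ^ 2)⁻¹ * ∫ x, Jf d j k (latVec m) s x) 0 hl2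
  rw [mul_zero, ← probK_eq] at h1
  have h2 : probK d j k m = l ^ 2 * ∫ t in Set.Ioi (0:ℝ), ((l ^ 2 * t) ^ 2)⁻¹ *
      ∫ x, Jf d j k (latVec m) (l ^ 2 * t) x := by
    rw [h1]; simp; field_simp
  rw [h2, ← mul_assoc, ← integral_const_mul]
  refine setIntegral_congr_fun measurableSet_Ioi fun t ht => ?_
  have ht : 0 < t := ht
  beta_reduce
  rw [integral_const_mul, Measure.integral_comp_smul_of_nonneg volume _ l (hR := hl.le)]
  simp only [finrank_euclideanSpace, Fintype.card_fin, smul_eq_mul]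
  field_simp
  ring

lemma heatK_meas2 {d : ℕ} : Measurable (fun q : ℝ × Eu d => heatK d q.1 q.2) := by
  unfold heatK; fun_prop

lemma pHeatK_meas2 {d : ℕ} : Measurable (fun q : ℝ × Eu d => pHeatK d q.1 q.2) := by
  simp_rw [pHeatK_eq]
  refine StronglyMeasurable.measurable ?_
  refine StronglyMeasurable.integral_prod_right (f := fun (q : ℝ × Eu d) (y : Eu d) =>
    heatK d q.1 (q.2 - latVec (flr y))) ?_
  refine Measurable.stronglyMeasurable ?_
  exact heatK_meas2.comp (measurable_fst.fst.prodMk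
    (measurable_fst.snd.sub (latVec_meas.comp (flr_meas.comp measurable_snd))))

lemma bmom_meas2 {d : ℕ} (j : Fin d) : Measurable (fun q : ℝ × Eu d => bmom d j q.1 q.2) := by
  unfold bmom
  simp_rw [tsum_eq_flr]
  refine StronglyMeasurable.measurable ?_
  refine StronglyMeasurable.integral_prod_right (f := fun (q : ℝ × Eu d) (y : Eu d) =>
    ((flr y j : ℝ) - q.2 j) * heatK d q.1 (q.2 - latVec (flr y))) ?_
  refine Measurable.stronglyMeasurable (Measurable.mul ?_ ?_)
  · refine Measurable.sub ?_ ?_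
    · have : Measurable (fun n : ZLat d => (n j : ℝ)) := measurable_of_countable _
      exact this.comp (flr_meas.comp measurable_snd)
    · have : Measurable (fun x : Eu d => x j) := by fun_prop
      exact this.comp measurable_fst.snd
  · exact heatK_meas2.comp (measurable_fst.fst.prodMk
      (measurable_fst.snd.sub (latVec_meas.comp (flr_meas.comp measurable_snd))))

lemma Jf_meas2 {d : ℕ} (j k : Fin d) (v : Eu d) :
    Measurable (fun q : ℝ × Eu d => Jf d j k v q.1 q.2) := by
  unfold Jf
  have h1 := heatK_meas2 (d := d)
  have h2 : Measurable (fun q : ℝ × Eu d => heatK d q.1 (q.2 - v)) :=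
    h1.comp (measurable_fst.prodMk (measurable_snd.sub_const v))
  have h3 := pHeatK_meas2 (d := d)
  have h4 := bmom_meas2 j
  have h5 := bmom_meas2 k
  have h6 : ∀ i : Fin d, Measurable (fun q : ℝ × Eu d => q.2 i) := fun i => by fun_prop
  exact ((h1.mul h2).div h3).mul (((h6 j).add (h4.div h3)).mul (((measurable_const.sub (h6 k))).sub (h5.div h3)))

/-- Scaled integrand. -/
def Sf (d : ℕ) (j k : Fin d) (m : ZLat d) (l t : ℝ) (u : Eu d) : ℝ :=
  l ^ (2 * d) * (l ^ 2)⁻¹ * Jf d j k (latVec m) (l ^ 2 * t) (l • u)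

lemma Sf_meas2 {d : ℕ} (j k : Fin d) (m : ZLat d) (l : ℝ) :
    Measurable (fun q : ℝ × Eu d => Sf d j k m l q.1 q.2) := by
  unfold Sf
  have h : Measurable (fun q : ℝ × Eu d => ((l ^ 2 * q.1, l • q.2) : ℝ × Eu d)) :=
    (measurable_fst.const_mul _).prodMk (measurable_snd.const_smul l)
  have h0 := Jf_meas2 j k (latVec m)
  generalize Jf d j k (latVec m) = J at h0 ⊢
  have h2 := h0.comp h
  exact h2.const_mul _

lemma Sf_int_meas {d : ℕ} (j k : Fin d) (m : ZLat d) (l : ℝ) :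
    Measurable (fun t : ℝ => (t ^ 2)⁻¹ * ∫ u, Sf d j k m l t u) := by
  refine Measurable.mul (by fun_prop) ?_
  exact (StronglyMeasurable.integral_prod_right (f := fun t u => Sf d j k m l t u)
    (Sf_meas2 j k m l).stronglyMeasurable).measurable

lemma Sf_eq {d : ℕ} (j k : Fin d) (m : ZLat d) {l t : ℝ} (hl : 0 < l) (ht : 0 < t) (u : Eu d) :
    Sf d j k m l t u = heatK d t u * heatK d t (u - l⁻¹ • latVec m) / pHeatK d (l ^ 2 * t) (l • u) *
      ((u j + l⁻¹ * (bmom d j (l ^ 2 * t) (l • u) / pHeatK d (l ^ 2 * t) (l • u))) *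
       ((l⁻¹ • latVec m) k - u k - l⁻¹ * (bmom d k (l ^ 2 * t) (l • u) / pHeatK d (l ^ 2 * t) (l • u)))) := by
  have e : l • u - latVec m = l • (u - l⁻¹ • latVec m) := by
    rw [smul_sub, smul_smul, mul_inv_cancel₀ hl.ne', one_smul]
  unfold Sf Jf
  rw [e, heatK_scale ht hl, heatK_scale ht hl]
  simp only [PiLp.smul_apply, smul_eq_mul]
  have hH := (pHeatK_pos (d := d) (show 0 < l ^ 2 * t by positivity) (l • u)).ne'
  field_simp
  ring

lemma Sf_bound (d : ℕ) : ∃ C : ℝ, 0 ≤ C ∧ ∀ (j k : Fin d) (m : ZLat d) (l t : ℝ) (u : Eu d),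
    1 ≤ l → 0 < t → |Sf d j k m l t u| ≤
      C * ((t ^ d)⁻¹ * exp (-(‖u‖ ^ 2 + ‖l⁻¹ • latVec m‖ ^ 2) / (16 * t))) *
      ((‖u‖ + 1 + √t) * (‖l⁻¹ • latVec m‖ + ‖u‖ + 1 + √t)) := by
  obtain ⟨C1, hC1, h1⟩ := b1 d
  obtain ⟨C2, hC2, h2⟩ := b2 d
  refine ⟨C1 * (1 + C2) ^ 2, by positivity, fun j k m l t u hl ht => ?_⟩
  have hl0 : 0 < l := by linarith
  set v := l⁻¹ • latVec m with hv
  set H := pHeatK d (l ^ 2 * t) (l • u) with hH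
  have hHp : 0 < H := pHeatK_pos (by positivity) _
  rw [Sf_eq j k m hl0 ht u, abs_mul, abs_mul]
  have hb : ∀ i, |l⁻¹ * (bmom d i (l ^ 2 * t) (l • u) / H)| ≤ C2 * (1 + √t) := by
    intro i
    rw [abs_mul, abs_of_pos (inv_pos.2 hl0)]
    have := h2 (l ^ 2 * t) (by positivity) (l • u) i
    rw [Real.sqrt_mul (by positivity), Real.sqrt_sq hl0.le] at this
    rw [inv_mul_le_iff₀ hl0]
    refine this.trans ?_
    have : 0 ≤ √t := Real.sqrt_nonneg t
    nlinarith
  have hst : 0 ≤ √t := Real.sqrt_nonneg t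
  have hu : ∀ i, |u i| ≤ ‖u‖ := fun i => PiLp.norm_apply_le u i
  have hvk : |v k| ≤ ‖v‖ := PiLp.norm_apply_le v k
  have t1 : |u j + l⁻¹ * (bmom d j (l ^ 2 * t) (l • u) / H)| ≤ (1 + C2) * (‖u‖ + 1 + √t) := by
    refine (abs_add_le _ _).trans ?_
    have := hb j; have := hu j
    nlinarith [norm_nonneg u]
  have t2 : |v k - u k - l⁻¹ * (bmom d k (l ^ 2 * t) (l • u) / H)| ≤ (1 + C2) * (‖v‖ + ‖u‖ + 1 + √t) := by
    have a1 := abs_sub (v k - u k) (l⁻¹ * (bmom d k (l ^ 2 * t) (l • u) / H))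
    have a2 := abs_sub (v k) (u k)
    have := hb k; have := hu k
    nlinarith [norm_nonneg u, norm_nonneg v]
  have t3 : |heatK d t u * heatK d t (u - v) / H| ≤
      C1 * ((t ^ d)⁻¹ * exp (-(‖u‖ ^ 2 + ‖v‖ ^ 2) / (16 * t))) := by
    have hp1 := heatK_pos ht u
    have hp2 := heatK_pos ht (u - v)
    rw [abs_of_nonneg (by positivity)]
    have := h1 (l ^ 2 * t) (by positivity) (l • u) m
    have e : l • u - latVec m = l • (u - v) := by
      rw [smul_sub, hv, smul_smul, mul_inv_cancel₀ hl0.ne', one_smul]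
    have e2 : latVec m = l • v := by rw [hv, smul_smul, mul_inv_cancel₀ hl0.ne', one_smul]
    rw [e, heatK_scale ht hl0, heatK_scale ht hl0, e2, norm_smul, norm_smul,
      Real.norm_of_nonneg hl0.le] at this
    have e3 : -((l * ‖u‖) ^ 2 + (l * ‖v‖) ^ 2) / (16 * (l ^ 2 * t)) = -(‖u‖ ^ 2 + ‖v‖ ^ 2) / (16 * t) := by
      field_simp
    rw [e3, ← hH] at this
    have e4 : (l ^ d) ^ 2 * ((l ^ d)⁻¹ * heatK d t u * ((l ^ d)⁻¹ * heatK d t (u - v)) / H) =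
      heatK d t u * heatK d t (u - v) / H := by field_simp
    have e5 : (l ^ d) ^ 2 * (C1 * (((l ^ 2 * t) ^ d)⁻¹ * exp (-(‖u‖ ^ 2 + ‖v‖ ^ 2) / (16 * t)))) =
      C1 * ((t ^ d)⁻¹ * exp (-(‖u‖ ^ 2 + ‖v‖ ^ 2) / (16 * t))) := by
      rw [mul_pow, ← pow_mul, ← pow_mul, mul_comm d 2]; field_simp
    rw [← e4, ← e5]
    gcongr
  calc _ ≤ C1 * ((t ^ d)⁻¹ * exp (-(‖u‖ ^ 2 + ‖v‖ ^ 2) / (16 * t))) *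
      (((1 + C2) * (‖u‖ + 1 + √t)) * ((1 + C2) * (‖v‖ + ‖u‖ + 1 + √t))) := by gcongr
    _ = _ := by ring

/-- Dominating function. -/
def bdf (d : ℕ) (δ t : ℝ) (u : Eu d) : ℝ :=
  ((t ^ d)⁻¹ * (1 + t) * exp (-(δ ^ 2 / 16) / t)) * exp (-(1 / (32 * t)) * ‖u‖ ^ 2)

lemma Sf_bound' (d : ℕ) (δ R : ℝ) (hδ : 0 ≤ δ) (hR : 0 ≤ R) : ∃ C : ℝ, 0 ≤ C ∧
    ∀ (j k : Fin d) (m : ZLat d) (l t : ℝ) (u : Eu d),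
    1 ≤ l → 0 < t → δ ≤ ‖l⁻¹ • latVec m‖ → ‖l⁻¹ • latVec m‖ ≤ R →
    |Sf d j k m l t u| ≤ C * bdf d δ t u := by
  obtain ⟨C, hC, h⟩ := Sf_bound d
  refine ⟨C * (99 * (R + 1) ^ 2), by positivity, fun j k m l t u hl ht h1 h2 => ?_⟩
  refine (h j k m l t u hl ht).trans ?_
  set v := l⁻¹ • latVec m
  have hs : √t ^ 2 = t := Real.sq_sqrt ht.le
  have hst : 0 ≤ √t := Real.sqrt_nonneg t
  have hu := norm_nonneg u
  have p1 : (‖u‖ + 1 + √t) * (‖v‖ + ‖u‖ + 1 + √t) ≤ 3 * (‖u‖ ^ 2 + (R + 1) ^ 2 + t) := by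
    calc _ ≤ (‖u‖ + (R + 1) + √t) * (‖u‖ + (R + 1) + √t) := by
          gcongr ?_ * ?_ <;> linarith
      _ ≤ _ := by
        nlinarith [sq_nonneg (‖u‖ - (R + 1)), sq_nonneg (‖u‖ - √t), sq_nonneg (√t - (R + 1))]
  set r := 1 / (32 * t) * ‖u‖ ^ 2 with hr
  have hr0 : 0 ≤ r := by positivity
  have hur : ‖u‖ ^ 2 = 32 * t * r := by rw [hr]; field_simp
  have p2 : exp (-(‖u‖ ^ 2 + ‖v‖ ^ 2) / (16 * t)) ≤ exp (-(2 * r)) * exp (-(δ ^ 2 / 16) / t) := by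
    rw [← Real.exp_add]
    refine Real.exp_le_exp.2 ?_
    rw [← sub_nonneg]
    have : -(2 * r) + -(δ ^ 2 / 16) / t - -(‖u‖ ^ 2 + ‖v‖ ^ 2) / (16 * t) = (‖v‖ ^ 2 - δ ^ 2) / (16 * t) := by
      rw [hur]; field_simp; ring
    rw [this]
    have : 0 ≤ ‖v‖ ^ 2 - δ ^ 2 := by nlinarith [norm_nonneg v]
    positivity
  have p3 : exp (-(2 * r)) * (‖u‖ ^ 2 + (R + 1) ^ 2 + t) ≤ exp (-r) * (33 * (R + 1) ^ 2 * (1 + t)) := by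
    have q1 : exp (-(2 * r)) = exp (-r) * exp (-r) := by rw [← Real.exp_add]; congr 1; ring
    have q2 : r * exp (-r) ≤ 1 := by
      have := Real.add_one_le_exp r
      rw [Real.exp_neg, ← div_eq_mul_inv, div_le_one (Real.exp_pos r)]; linarith
    have q3 : exp (-r) ≤ 1 := Real.exp_le_one_iff.2 (by linarith)
    rw [q1, mul_assoc, hur]
    refine mul_le_mul_of_nonneg_left ?_ (Real.exp_pos _).le
    have hR1 : 1 ≤ (R + 1) ^ 2 := by nlinarith
    calc exp (-r) * (32 * t * r + (R + 1) ^ 2 + t) = 32 * t * (r * exp (-r)) + exp (-r) * ((R + 1) ^ 2 + t) := by ring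
      _ ≤ 32 * t * 1 + 1 * ((R + 1) ^ 2 + t) := by gcongr
      _ ≤ _ := by nlinarith
  have e1 : bdf d δ t u = ((t ^ d)⁻¹ * (1 + t) * exp (-(δ ^ 2 / 16) / t)) * exp (-r) := by
    unfold bdf; rw [neg_mul]
  rw [e1]
  calc _ ≤ C * ((t ^ d)⁻¹ * (exp (-(2 * r)) * exp (-(δ ^ 2 / 16) / t))) * (3 * (‖u‖ ^ 2 + (R + 1) ^ 2 + t)) := by
        gcongr
    _ = 3 * C * (t ^ d)⁻¹ * exp (-(δ ^ 2 / 16) / t) * (exp (-(2 * r)) * (‖u‖ ^ 2 + (R + 1) ^ 2 + t)) := by ring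
    _ ≤ 3 * C * (t ^ d)⁻¹ * exp (-(δ ^ 2 / 16) / t) * (exp (-r) * (33 * (R + 1) ^ 2 * (1 + t))) := by
        gcongr
    _ = _ := by ring

lemma bdf_int {d : ℕ} (δ : ℝ) {t : ℝ} (ht : 0 < t) : Integrable (bdf d δ t) :=
  (gauss_int (b := 1 / (32 * t)) (by positivity)).const_mul _

lemma bdf_val {d : ℕ} (δ : ℝ) {t : ℝ} (ht : 0 < t) :
    ∫ u, bdf d δ t u = (32 * π) ^ ((d:ℝ) / 2) * (t ^ (-(d:ℝ) / 2) * (1 + t) * exp (-(δ ^ 2 / 16) / t)) := by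
  unfold bdf
  rw [integral_const_mul, gauss_val (by positivity)]
  have : π / (1 / (32 * t)) = (32 * π) * t := by field_simp
  rw [this, Real.mul_rpow (by positivity) ht.le]
  have h2 : (t ^ d)⁻¹ * t ^ ((d:ℝ) / 2) = t ^ (-(d:ℝ) / 2) := by
    rw [← Real.rpow_natCast, ← Real.rpow_neg ht.le, ← Real.rpow_add ht]; congr 1; ring
  rw [← h2]; ring

lemma tint_val {a c : ℝ} (ha : 0 < a) (hc : 0 < c) :
    ∫ t in Set.Ioi (0:ℝ), t ^ (-a - 1) * exp (-c / t) = (1 / c) ^ a * Gamma a := by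
  rw [← integral_rpow_mul_exp_neg_mul_Ioi ha hc, ← integral_comp_rpow_Ioi _ (p := -1) (by norm_num)]
  refine setIntegral_congr_fun measurableSet_Ioi fun t ht => ?_
  have ht' : (0:ℝ) < t := ht
  simp only [abs_neg, abs_one, one_mul, smul_eq_mul]
  rw [← Real.rpow_mul ht'.le, ← mul_assoc, ← Real.rpow_add ht', Real.rpow_neg_one]
  congr 1
  · congr 1; ring
  · congr 1; field_simp

lemma tint_int {a c : ℝ} (ha : 0 < a) (hc : 0 < c) :
    IntegrableOn (fun t => t ^ (-a - 1) * exp (-c / t)) (Set.Ioi (0:ℝ)) := by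
  refine Integrable.of_integral_ne_zero ?_
  rw [tint_val ha hc]
  have := Gamma_pos_of_pos ha
  positivity

lemma bdf_t_int {d : ℕ} (hd : 1 ≤ d) {δ : ℝ} (hδ : 0 < δ) :
    IntegrableOn (fun t => (t ^ 2)⁻¹ * ∫ u, bdf d δ t u) (Set.Ioi (0:ℝ)) := by
  have hd' : (1:ℝ) ≤ d := by exact_mod_cast hd
  have h1 := tint_int (a := (d:ℝ) / 2 + 1) (c := δ ^ 2 / 16) (by positivity) (by positivity)
  have h2 := tint_int (a := (d:ℝ) / 2) (c := δ ^ 2 / 16) (by positivity) (by positivity)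
  have h3 : IntegrableOn _ (Set.Ioi (0:ℝ)) := (h1.add h2).const_mul ((32 * π) ^ ((d:ℝ) / 2))
  refine h3.congr_fun (fun t ht => ?_) measurableSet_Ioi
  have ht' : (0:ℝ) < t := ht
  simp only [Pi.add_apply]
  rw [bdf_val δ ht']
  have e1 : t ^ (-((d:ℝ) / 2 + 1) - 1) = (t ^ 2)⁻¹ * t ^ (-(d:ℝ) / 2) := by
    rw [← Real.rpow_natCast, ← Real.rpow_neg ht'.le, ← Real.rpow_add ht']; congr 1; push_cast; ring
  have e2 : t ^ (-((d:ℝ) / 2) - 1) = (t ^ 2)⁻¹ * t ^ (-(d:ℝ) / 2) * t := by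
    rw [← e1, ← Real.rpow_add_one ht'.ne']; congr 1; ring
  rw [e1, e2]; ring

lemma probK_eq_Sf {d : ℕ} (j k : Fin d) (m : ZLat d) {l : ℝ} (hl : 0 < l) :
    l ^ d * probK d j k m = ∫ t in Set.Ioi (0:ℝ), (t ^ 2)⁻¹ * ∫ u, Sf d j k m l t u :=
  probK_scale j k m hl

lemma probK_bound {d : ℕ} (hd : 1 ≤ d) : ∃ C : ℝ, 0 ≤ C ∧ ∀ (j k : Fin d) (m : ZLat d), m ≠ 0 →
    ‖latVec m‖ ^ d * |probK d j k m| ≤ C := by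
  obtain ⟨C, hC, h⟩ := Sf_bound' d 1 1 zero_le_one zero_le_one
  refine ⟨∫ t in Set.Ioi (0:ℝ), C * ((t ^ 2)⁻¹ * ∫ u, bdf d 1 t u), ?_, fun j k m hm => ?_⟩
  · refine setIntegral_nonneg measurableSet_Ioi fun t ht => mul_nonneg hC (mul_nonneg (by positivity) ?_)
    have ht' : (0:ℝ) < t := ht
    rw [bdf_val 1 ht']; positivity
  · have hl := one_le_norm_latVec m hm
    have hl0 : 0 < ‖latVec m‖ := by linarith
    have hn : ‖(‖latVec m‖)⁻¹ • latVec m‖ = 1 := by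
      rw [norm_smul, norm_inv, norm_norm, inv_mul_cancel₀ hl0.ne']
    rw [← abs_of_nonneg (show 0 ≤ ‖latVec m‖ ^ d by positivity), ← abs_mul, probK_eq_Sf j k m hl0]
    refine norm_integral_le_of_norm_le (f := fun t => (t ^ 2)⁻¹ * ∫ u, Sf d j k m ‖latVec m‖ t u)
      ((bdf_t_int hd one_pos).const_mul C) ?_
    refine (ae_restrict_iff' measurableSet_Ioi).2 (Eventually.of_forall fun t ht => ?_)
    have ht' : (0:ℝ) < t := ht
    rw [norm_mul, Real.norm_of_nonneg (by positivity), mul_left_comm, ← integral_const_mul]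
    refine mul_le_mul_of_nonneg_left ?_ (by positivity)
    refine norm_integral_le_of_norm_le ((bdf_int 1 ht').const_mul C) (Eventually.of_forall fun u => ?_)
    exact h j k m _ t u hl ht' hn.ge hn.le

lemma scale_meas {d : ℕ} (N : ℝ) : Measurable (fun y : Eu d => N⁻¹ • latVec (flr (N • y))) := by
  have h : Measurable (fun y : Eu d => N • y) := by fun_prop
  have h2 : Measurable (fun y : Eu d => latVec (flr (N • y))) := latVec_meas.comp (flr_meas.comp h)
  fun_prop

lemma riem {d : ℕ} {φ : Eu d → ℝ} (hφ : Continuous φ) {K t : ℝ} (ht : 0 < t)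
    (hb : ∀ z, |φ z| ≤ K * heatK d t z) (u : Eu d) :
    Tendsto (fun N : ℕ => ∫ y, φ (u - (N:ℝ)⁻¹ • latVec (flr ((N:ℝ) • y)))) atTop (nhds (∫ z, φ z)) := by
  have hK : 0 ≤ K := by
    have := (abs_nonneg _).trans (hb 0)
    exact nonneg_of_mul_nonneg_left this (heatK_pos ht 0)
  rw [← integral_sub_left_eq_self φ volume u]
  refine tendsto_integral_filter_of_dominated_convergence
    (fun y => K * (exp (d / (2 * t)) * 2 ^ ((d:ℝ) / 2) * heatK d (2 * t) (u - y))) ?_ ?_ ?_ ?_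
  · refine Eventually.of_forall fun N => ?_
    refine (hφ.measurable.comp ?_).aestronglyMeasurable
    exact measurable_const.sub (scale_meas _)
  · filter_upwards [eventually_ge_atTop 1] with N hN
    refine Eventually.of_forall fun y => (hb _).trans ?_
    gcongr
    refine heatK_le_near ht _ _ ?_
    have hN' : (1:ℝ) ≤ N := by exact_mod_cast hN
    have := norm_sub_flr_scale (N:ℝ) (by positivity) y
    rw [show u - (N:ℝ)⁻¹ • latVec (flr ((N:ℝ) • y)) - (u - y) = y - (N:ℝ)⁻¹ • latVec (flr ((N:ℝ) • y)) by abel]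
    have h2 : √(d:ℝ) / N ≤ √d := div_le_self (Real.sqrt_nonneg _) hN'
    calc _ ≤ √(d:ℝ) ^ 2 := by gcongr; linarith
      _ = d := Real.sq_sqrt (by positivity)
  · exact ((heatK_int_sub (by positivity) u).const_mul _).const_mul _
  · refine Eventually.of_forall fun y => ?_
    exact (hφ.tendsto _).comp (tendsto_const_nhds.sub (flr_scale_tendsto y))

lemma pHeatK_lim {d : ℕ} {t : ℝ} (ht : 0 < t) (u : Eu d) :
    Tendsto (fun N : ℕ => pHeatK d ((N:ℝ) ^ 2 * t) ((N:ℝ) • u)) atTop (nhds 1) := by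
  have := riem (heatK_cont (d := d) t) (K := 1) ht (fun z => by rw [abs_of_pos (heatK_pos ht z), one_mul]) u
  rw [heatK_val ht] at this
  refine this.congr' ?_
  filter_upwards [eventually_ge_atTop 1] with N hN
  have hN' : (0:ℝ) < N := by exact_mod_cast hN
  unfold pHeatK
  rw [tsum_eq_flr_scale _ (N:ℝ) hN', ← integral_const_mul]
  congr 1; ext y
  have e : (N:ℝ) • u - latVec (flr ((N:ℝ) • y)) = (N:ℝ) • (u - (N:ℝ)⁻¹ • latVec (flr ((N:ℝ) • y))) := by
    rw [smul_sub, smul_smul, mul_inv_cancel₀ hN'.ne', one_smul]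
  rw [e, heatK_scale ht hN', ← mul_assoc, mul_inv_cancel₀ (by positivity), one_mul]

lemma bmom_lim {d : ℕ} {t : ℝ} (ht : 0 < t) (u : Eu d) (j : Fin d) :
    Tendsto (fun N : ℕ => (N:ℝ)⁻¹ * bmom d j ((N:ℝ) ^ 2 * t) ((N:ℝ) • u)) atTop (nhds 0) := by
  have hc := heatK_cont (d := d) t
  have := riem (φ := fun z : Eu d => -(z j) * heatK d t z) (by fun_prop) (K := 2 * √t * 2 ^ ((d:ℝ) / 2))
    (t := 2 * t) (by positivity) (fun z => by
      rw [abs_mul, abs_of_pos (heatK_pos ht z), abs_neg, mul_assoc]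
      refine le_trans ?_ (norm_mul_heatK ht z)
      gcongr
      · exact (heatK_pos ht z).le
      · exact PiLp.norm_apply_le z j) u
  have h0 : ∫ z : Eu d, -(z j) * heatK d t z = 0 := by
    have := integral_neg_eq_self (fun z : Eu d => -(z j) * heatK d t z) volume
    simp only [heatK_neg, PiLp.neg_apply, neg_neg, neg_mul, integral_neg] at this ⊢
    linarith
  rw [h0] at this
  refine this.congr' ?_
  filter_upwards [eventually_ge_atTop 1] with N hN
  have hN' : (0:ℝ) < N := by exact_mod_cast hN
  unfold bmom
  rw [tsum_eq_flr_scale _ (N:ℝ) hN', ← integral_const_mul, ← integral_const_mul]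
  congr 1; ext y
  have e : (N:ℝ) • u - latVec (flr ((N:ℝ) • y)) = (N:ℝ) • (u - (N:ℝ)⁻¹ • latVec (flr ((N:ℝ) • y))) := by
    rw [smul_sub, smul_smul, mul_inv_cancel₀ hN'.ne', one_smul]
  rw [e, heatK_scale ht hN']
  simp only [PiLp.sub_apply, PiLp.smul_apply, smul_eq_mul, latVec_apply]
  field_simp
  ring

/-- Limit integrand. -/
def Lf (d : ℕ) (j k : Fin d) (y : Eu d) (t : ℝ) (u : Eu d) : ℝ :=
  heatK d t u * heatK d t (u - y) * (u j * (y k - u k))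

lemma Sf_lim {d : ℕ} (j k : Fin d) {m : ℕ → ZLat d} {y : Eu d}
    (hm : Tendsto (fun N : ℕ => (N:ℝ)⁻¹ • latVec (m N)) atTop (nhds y)) {t : ℝ} (ht : 0 < t) (u : Eu d) :
    Tendsto (fun N : ℕ => Sf d j k (m N) N t u) atTop (nhds (Lf d j k y t u)) := by
  have h1 := pHeatK_lim ht u
  have hb : ∀ i, Tendsto (fun N : ℕ => (N:ℝ)⁻¹ * (bmom d i ((N:ℝ) ^ 2 * t) ((N:ℝ) • u) /
      pHeatK d ((N:ℝ) ^ 2 * t) ((N:ℝ) • u))) atTop (nhds 0) := by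
    intro i
    have := (bmom_lim ht u i).div h1 one_ne_zero
    rw [zero_div] at this
    refine this.congr fun N => ?_
    simp only [Pi.div_apply, mul_div_assoc]
  have h2 : Tendsto (fun N : ℕ => heatK d t (u - (N:ℝ)⁻¹ • latVec (m N))) atTop (nhds (heatK d t (u - y))) :=
    ((heatK_cont t).tendsto _).comp (tendsto_const_nhds.sub hm)
  have h3 : Tendsto (fun N : ℕ => ((N:ℝ)⁻¹ • latVec (m N)) k) atTop (nhds (y k)) :=
    ((show Continuous (fun z : Eu d => z k) by fun_prop).tendsto _).comp hm
  have := (((tendsto_const_nhds (x := heatK d t u)).mul h2).div h1 one_ne_zero).mul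
    (((tendsto_const_nhds (x := u j)).add (hb j)).mul ((h3.sub (tendsto_const_nhds (x := u k))).sub (hb k)))
  simp only [div_one, add_zero, sub_zero] at this
  refine this.congr' ?_
  filter_upwards [eventually_ge_atTop 1] with N hN
  have hN' : (0:ℝ) < N := by exact_mod_cast hN
  exact (Sf_eq j k (m N) hN' ht u).symm

lemma probK_lim {d : ℕ} (hd : 1 ≤ d) (j k : Fin d) {m : ℕ → ZLat d} {y : Eu d} (hy : y ≠ 0)
    (hm : Tendsto (fun N : ℕ => (N:ℝ)⁻¹ • latVec (m N)) atTop (nhds y)) :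
    Tendsto (fun N : ℕ => (N:ℝ) ^ d * probK d j k (m N)) atTop
      (nhds (∫ t in Set.Ioi (0:ℝ), (t ^ 2)⁻¹ * ∫ u, Lf d j k y t u)) ∧
    IntegrableOn (fun t => (t ^ 2)⁻¹ * ∫ u, Lf d j k y t u) (Set.Ioi (0:ℝ)) := by
  have hy0 : 0 < ‖y‖ := norm_pos_iff.2 hy
  obtain ⟨C, hC, h⟩ := Sf_bound' d (‖y‖ / 2) (2 * ‖y‖) (by positivity) (by positivity)
  have ev : ∀ᶠ N : ℕ in atTop, ∀ t u, 0 < t → |Sf d j k (m N) N t u| ≤ C * bdf d (‖y‖ / 2) t u := by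
    have e1 := hm.norm.eventually (lt_mem_nhds (show ‖y‖ / 2 < ‖y‖ by linarith))
    have e2 := hm.norm.eventually (gt_mem_nhds (show ‖y‖ < 2 * ‖y‖ by linarith))
    filter_upwards [e1, e2, eventually_ge_atTop 1] with N h1 h2 hN t u ht
    exact h j k (m N) N t u (by exact_mod_cast hN) ht h1.le h2.le
  have inner : ∀ t : ℝ, 0 < t → Tendsto (fun N : ℕ => (t ^ 2)⁻¹ * ∫ u, Sf d j k (m N) N t u) atTop
      (nhds ((t ^ 2)⁻¹ * ∫ u, Lf d j k y t u)) := by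
    intro t ht
    refine Tendsto.const_mul _ ?_
    refine tendsto_integral_filter_of_dominated_convergence (fun u => C * bdf d (‖y‖ / 2) t u) ?_ ?_
      ((bdf_int _ ht).const_mul C) ?_
    · refine Eventually.of_forall fun N => ?_
      exact ((Sf_meas2 j k (m N) N).comp (measurable_const.prodMk measurable_id)).aestronglyMeasurable
    · filter_upwards [ev] with N hN
      exact Eventually.of_forall fun u => hN t u ht
    · exact Eventually.of_forall fun u => Sf_lim j k hm ht u
  have bd : ∀ᶠ N : ℕ in atTop, ∀ t, 0 < t → ‖(t ^ 2)⁻¹ * ∫ u, Sf d j k (m N) N t u‖ ≤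
      C * ((t ^ 2)⁻¹ * ∫ u, bdf d (‖y‖ / 2) t u) := by
    filter_upwards [ev] with N hN t ht
    rw [norm_mul, Real.norm_of_nonneg (by positivity), mul_left_comm, ← integral_const_mul]
    refine mul_le_mul_of_nonneg_left ?_ (by positivity)
    exact norm_integral_le_of_norm_le ((bdf_int _ ht).const_mul C) (Eventually.of_forall fun u => hN t u ht)
  have hint := (bdf_t_int hd (show 0 < ‖y‖ / 2 by positivity)).const_mul C
  have hlim : ∀ᵐ t ∂(volume.restrict (Set.Ioi (0:ℝ))),
      Tendsto (fun N : ℕ => (t ^ 2)⁻¹ * ∫ u, Sf d j k (m N) N t u) atTop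
      (nhds ((t ^ 2)⁻¹ * ∫ u, Lf d j k y t u)) :=
    (ae_restrict_iff' measurableSet_Ioi).2 (Eventually.of_forall fun t ht => inner t ht)
  have hmeas : ∀ N : ℕ, AEStronglyMeasurable (fun t => (t ^ 2)⁻¹ * ∫ u, Sf d j k (m N) N t u)
      (volume.restrict (Set.Ioi (0:ℝ))) := fun N => (Sf_int_meas j k (m N) N).aestronglyMeasurable
  constructor
  · have := tendsto_integral_filter_of_dominated_convergence
      (fun t => C * ((t ^ 2)⁻¹ * ∫ u, bdf d (‖y‖ / 2) t u)) (Eventually.of_forall hmeas) (by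
        filter_upwards [bd] with N hN
        exact (ae_restrict_iff' measurableSet_Ioi).2 (Eventually.of_forall fun t ht => hN t ht)) hint hlim
    refine this.congr' ?_
    filter_upwards [eventually_ge_atTop 1] with N hN
    have hN' : (0:ℝ) < N := by exact_mod_cast hN
    exact (probK_eq_Sf j k (m N) hN').symm
  · refine Integrable.mono' hint (aestronglyMeasurable_of_tendsto_ae atTop hmeas hlim) ?_
    refine (ae_restrict_iff' measurableSet_Ioi).2 (Eventually.of_forall fun t ht => ?_)
    exact le_of_tendsto (inner t ht).norm (bd.mono fun N hN => hN t ht)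

/-- Signed coordinate reflection. -/
def reflE {d : ℕ} (j : Fin d) : Eu d ≃ₗᵢ[ℝ] Eu d :=
  LinearIsometryEquiv.piLpCongrRight 2 (fun i => if i = j then LinearIsometryEquiv.neg ℝ else LinearIsometryEquiv.refl ℝ ℝ)

lemma reflE_apply {d : ℕ} (j : Fin d) (x : Eu d) (i : Fin d) :
    reflE j x i = (if i = j then -1 else 1) * x i := by
  simp only [reflE, LinearIsometryEquiv.piLpCongrRight_apply]
  split_ifs <;> simp

/-- Coordinate swap. -/
def swapE {d : ℕ} (j k : Fin d) : Eu d ≃ₗᵢ[ℝ] Eu d :=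
  LinearIsometryEquiv.piLpCongrLeft 2 ℝ ℝ (Equiv.swap j k)

lemma swapE_apply {d : ℕ} (j k : Fin d) (x : Eu d) (i : Fin d) :
    swapE j k x i = x (Equiv.swap j k i) := by
  simp [swapE, LinearIsometryEquiv.piLpCongrLeft_apply, Equiv.piCongrLeft', Equiv.symm_swap]

/-- Lattice reflection. -/
def reflZ {d : ℕ} (j : Fin d) : ZLat d ≃ ZLat d :=
  Function.Involutive.toPerm (fun n i => (if i = j then -1 else 1) * n i) (by
    intro n; ext i; simp only; split_ifs <;> simp)

/-- Lattice swap. -/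
def swapZ {d : ℕ} (j k : Fin d) : ZLat d ≃ ZLat d :=
  Function.Involutive.toPerm (fun n i => n (Equiv.swap j k i)) (by
    intro n; ext i; simp)

lemma reflZ_vec {d : ℕ} (j : Fin d) (n : ZLat d) : latVec (reflZ j n) = reflE j (latVec n) := by
  ext i
  rw [reflE_apply, latVec_apply, latVec_apply]
  simp [reflZ]

lemma swapZ_vec {d : ℕ} (j k : Fin d) (n : ZLat d) : latVec (swapZ j k n) = swapE j k (latVec n) := by
  ext i
  rw [swapE_apply, latVec_apply, latVec_apply]
  rfl

lemma heatK_sym {d : ℕ} (σ : Eu d ≃ₗᵢ[ℝ] Eu d) (t : ℝ) (x : Eu d) : heatK d t (σ x) = heatK d t x := by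
  simp [heatK]

lemma pHeatK_sym {d : ℕ} (σ : Eu d ≃ₗᵢ[ℝ] Eu d) (τ : ZLat d ≃ ZLat d) (hτ : ∀ n, latVec (τ n) = σ (latVec n))
    (t : ℝ) (x : Eu d) : pHeatK d t (σ x) = pHeatK d t x := by
  unfold pHeatK
  rw [← Equiv.tsum_eq τ]
  simp only [hτ, ← map_sub, heatK_sym]

lemma bmom_sym {d : ℕ} (σ : Eu d ≃ₗᵢ[ℝ] Eu d) (τ : ZLat d ≃ ZLat d) (hτ : ∀ n, latVec (τ n) = σ (latVec n))
    (t : ℝ) (x : Eu d) {i i' : Fin d} {c : ℝ} (hc : ∀ x, σ x i = c * x i') :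
    bmom d i t (σ x) = c * bmom d i' t x := by
  unfold bmom
  rw [← Equiv.tsum_eq τ, ← tsum_mul_left]
  congr 1; ext n
  have : ((τ n i : ℤ) : ℝ) = c * n i' := by
    rw [← latVec_apply (τ n), hτ, hc, latVec_apply]
  rw [hτ, ← map_sub, heatK_sym, this, hc]; ring

lemma probK_sym {d : ℕ} (σ : Eu d ≃ₗᵢ[ℝ] Eu d) (τ : ZLat d ≃ ZLat d) (hτ : ∀ n, latVec (τ n) = σ (latVec n))
    {j j' k k' : Fin d} {c c' : ℝ} (hc : ∀ x, σ x j = c * x j') (hc' : ∀ x, σ x k = c' * x k') (m : ZLat d) :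
    probK d j k (τ m) = c * c' * probK d j' k' m := by
  rw [probK_eq, probK_eq, ← integral_const_mul]
  congr 1; ext s
  rw [mul_left_comm]; congr 1
  rw [← integral_const_mul, ← (LinearIsometryEquiv.measurePreserving σ).integral_comp
    σ.toHomeomorph.measurableEmbedding]
  congr 1; ext x
  unfold Jf
  rw [hτ, ← map_sub, heatK_sym, heatK_sym, pHeatK_sym σ τ hτ, bmom_sym σ τ hτ s x hc, bmom_sym σ τ hτ s x hc']
  rw [hc, hc', hc']
  ring

lemma probK_refl {d : ℕ} {j k : Fin d} (h : j ≠ k) (m : ZLat d) :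
    probK d j k (reflZ j m) = - probK d j k m := by
  rw [probK_sym (reflE j) (reflZ j) (reflZ_vec j) (c := -1) (c' := 1) (j' := j) (k' := k)]
  · ring
  · intro x; simp [reflE_apply]
  · intro x; simp [reflE_apply, h.symm]

lemma probK_swap {d : ℕ} {j k : Fin d} (m : ZLat d) :
    probK d j j (swapZ j k m) - probK d k k (swapZ j k m) = - (probK d j j m - probK d k k m) := by
  rw [probK_sym (swapE j k) (swapZ j k) (swapZ_vec j k) (c := 1) (c' := 1) (j' := k) (k' := k),
    probK_sym (swapE j k) (swapZ j k) (swapZ_vec j k) (c := 1) (c' := 1) (j' := j) (k' := j)]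
  · ring
  all_goals intro x; simp [swapE_apply]

lemma poly_gauss_int {d : ℕ} {b C : ℝ} (hb : 0 < b) {q : Eu d → ℝ} (hq : Continuous q)
    (h : ∀ v, |q v| ≤ C * (1 + ‖v‖ ^ 2)) : Integrable (fun v => q v * exp (-b * ‖v‖ ^ 2)) := by
  have hC : 0 ≤ C := by
    have := (abs_nonneg _).trans (h 0); simpa using this
  refine Integrable.mono' ((gauss_int (d := d) (b := b / 2) (by positivity)).const_mul (C * (1 + 2 / b)))
    (by fun_prop) (Eventually.of_forall fun v => ?_)
  rw [norm_mul, Real.norm_of_nonneg (Real.exp_pos _).le]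
  have e : exp (-b * ‖v‖ ^ 2) = exp (-(b / 2 * ‖v‖ ^ 2)) * exp (-(b / 2) * ‖v‖ ^ 2) := by
    rw [← Real.exp_add]; congr 1; ring
  rw [e, ← mul_assoc]
  refine mul_le_mul_of_nonneg_right ?_ (Real.exp_pos _).le
  set r := b / 2 * ‖v‖ ^ 2 with hr
  have hr0 : 0 ≤ r := by positivity
  have hv : ‖v‖ ^ 2 = 2 / b * r := by rw [hr]; field_simp
  have q2 : r * exp (-r) ≤ 1 := by
    have := Real.add_one_le_exp r
    rw [Real.exp_neg, ← div_eq_mul_inv, div_le_one (Real.exp_pos r)]; linarith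
  have q3 : exp (-r) ≤ 1 := Real.exp_le_one_iff.2 (by linarith)
  calc |q v| * exp (-r) ≤ C * (1 + ‖v‖ ^ 2) * exp (-r) := by gcongr; exact h v
    _ = C * (exp (-r) + 2 / b * (r * exp (-r))) := by rw [hv]; ring
    _ ≤ C * (1 + 2 / b * 1) := by gcongr
    _ = _ := by ring

lemma coord_sq {d : ℕ} (v : Eu d) (i : Fin d) : |v i| ≤ 1 * (1 + ‖v‖ ^ 2) := by
  have := PiLp.norm_apply_le v i
  rw [Real.norm_eq_abs] at this
  nlinarith [sq_nonneg (‖v‖ - 1 / 2)]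

lemma coord_mul {d : ℕ} (v : Eu d) (i i' : Fin d) : |v i * v i'| ≤ 1 * (1 + ‖v‖ ^ 2) := by
  have h1 := PiLp.norm_apply_le v i
  have h2 := PiLp.norm_apply_le v i'
  rw [Real.norm_eq_abs] at h1 h2
  rw [abs_mul]
  nlinarith [mul_le_mul h1 h2 (abs_nonneg _) (norm_nonneg _)]

lemma Lf_val {d : ℕ} (j k : Fin d) (y : Eu d) {t : ℝ} (ht : 0 < t) :
    ∫ u, Lf d j k y t u = ((2 * π * t) ^ (-(d:ℝ) / 2)) ^ 2 * exp (-(‖y‖ ^ 2 / 4) / t) *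
      (y j * y k / 4 * (π * t) ^ ((d:ℝ) / 2) - ∫ v : Eu d, v j * v k * exp (-(1 / t) * ‖v‖ ^ 2)) := by
  rw [← integral_add_right_eq_self (Lf d j k y t) ((2:ℝ)⁻¹ • y)]
  have e : ∀ v : Eu d, Lf d j k y t (v + (2:ℝ)⁻¹ • y) = ((2 * π * t) ^ (-(d:ℝ) / 2)) ^ 2 * exp (-(‖y‖ ^ 2 / 4) / t) *
      (y j * y k / 4 * exp (-(1 / t) * ‖v‖ ^ 2) + (y k / 2 * (v j * exp (-(1 / t) * ‖v‖ ^ 2))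
        - y j / 2 * (v k * exp (-(1 / t) * ‖v‖ ^ 2))) - v j * v k * exp (-(1 / t) * ‖v‖ ^ 2)) := by
    intro v
    unfold Lf heatK
    have e1 : v + (2:ℝ)⁻¹ • y - y = v - (2:ℝ)⁻¹ • y := by
      have : y = (2:ℝ)⁻¹ • y + (2:ℝ)⁻¹ • y := by rw [← add_smul]; norm_num
      nth_rewrite 2 [this]; abel
    rw [e1]
    have e2 := parallelogram_law_with_norm ℝ v ((2:ℝ)⁻¹ • y)
    rw [norm_smul ((2:ℝ)⁻¹) y, norm_inv, Real.norm_of_nonneg (by norm_num)] at e2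
    have e3 : exp (-‖v + (2:ℝ)⁻¹ • y‖ ^ 2 / (2 * t)) * exp (-‖v - (2:ℝ)⁻¹ • y‖ ^ 2 / (2 * t)) =
        exp (-(‖y‖ ^ 2 / 4) / t) * exp (-(1 / t) * ‖v‖ ^ 2) := by
      rw [← Real.exp_add, ← Real.exp_add]; congr 1
      generalize ‖v + (2:ℝ)⁻¹ • y‖ = a at e2 ⊢
      generalize ‖v - (2:ℝ)⁻¹ • y‖ = b at e2 ⊢
      rw [← add_div, div_eq_iff (by positivity)]
      field_simp
      linear_combination -4 * e2
    simp only [PiLp.add_apply, PiLp.smul_apply, smul_eq_mul]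
    linear_combination ((2 * π * t) ^ (-(d:ℝ) / 2)) ^ 2 * ((v j + 2⁻¹ * y j) * (y k - (v k + 2⁻¹ * y k))) * e3
  simp only [e]
  have hb : 0 < 1 / t := by positivity
  have i0 := gauss_int (d := d) hb
  have i1 : ∀ i : Fin d, Integrable (fun v : Eu d => v i * exp (-(1 / t) * ‖v‖ ^ 2)) := fun i =>
    poly_gauss_int hb (by fun_prop) (fun v => coord_sq v i)
  have i2 : Integrable (fun v : Eu d => v j * v k * exp (-(1 / t) * ‖v‖ ^ 2)) :=
    poly_gauss_int hb (by fun_prop) (fun v => coord_mul v j k)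
  have z : ∀ i : Fin d, ∫ v : Eu d, v i * exp (-(1 / t) * ‖v‖ ^ 2) = 0 := by
    intro i
    have := integral_neg_eq_self (fun v : Eu d => v i * exp (-(1 / t) * ‖v‖ ^ 2)) volume
    simp only [PiLp.neg_apply, norm_neg, neg_mul, integral_neg] at this ⊢
    linarith
  rw [integral_const_mul, integral_sub, integral_add, integral_sub]
  · simp only [integral_const_mul, z]
    rw [gauss_val hb, show π / (1 / t) = π * t by field_simp]
    ring
  · exact (i1 j).const_mul _
  · exact (i1 k).const_mul _
  · exact i0.const_mul _
  · exact ((i1 j).const_mul _).sub ((i1 k).const_mul _)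
  · exact (i0.const_mul _).add (((i1 j).const_mul _).sub ((i1 k).const_mul _))
  · exact i2

lemma cross_zero {d : ℕ} {j k : Fin d} (h : j ≠ k) (b : ℝ) :
    ∫ v : Eu d, v j * v k * exp (-b * ‖v‖ ^ 2) = 0 := by
  have := (LinearIsometryEquiv.measurePreserving (reflE j)).integral_comp
    (reflE j).toHomeomorph.measurableEmbedding (fun v : Eu d => v j * v k * exp (-b * ‖v‖ ^ 2))
  simp only [LinearIsometryEquiv.norm_map, reflE_apply, if_pos, if_neg h.symm, neg_mul, one_mul, integral_neg] at this ⊢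
  linarith

lemma sq_swap {d : ℕ} (j k : Fin d) (b : ℝ) :
    ∫ v : Eu d, v j * v j * exp (-b * ‖v‖ ^ 2) = ∫ v : Eu d, v k * v k * exp (-b * ‖v‖ ^ 2) := by
  have := (LinearIsometryEquiv.measurePreserving (swapE j k)).integral_comp
    (swapE j k).toHomeomorph.measurableEmbedding (fun v : Eu d => v k * v k * exp (-b * ‖v‖ ^ 2))
  simp only [LinearIsometryEquiv.norm_map, swapE_apply, Equiv.swap_apply_right] at this ⊢
  exact this

lemma t_val {d : ℕ} {y : Eu d} (hy : y ≠ 0) (A : ℝ) :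
    ∫ t in Set.Ioi (0:ℝ), (t ^ 2)⁻¹ * (((2 * π * t) ^ (-(d:ℝ) / 2)) ^ 2 * exp (-(‖y‖ ^ 2 / 4) / t) *
      (A / 4 * (π * t) ^ ((d:ℝ) / 2))) = cConst d * (A / ‖y‖ ^ (d + 2)) := by
  have hy0 : 0 < ‖y‖ := norm_pos_iff.2 hy
  have e : ∀ t ∈ Set.Ioi (0:ℝ), (t ^ 2)⁻¹ * (((2 * π * t) ^ (-(d:ℝ) / 2)) ^ 2 * exp (-(‖y‖ ^ 2 / 4) / t) *
      (A / 4 * (π * t) ^ ((d:ℝ) / 2))) = (A / 4 * (2 ^ d)⁻¹ * π ^ (-(d:ℝ) / 2)) *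
        (t ^ (-((d:ℝ) / 2 + 1) - 1) * exp (-(‖y‖ ^ 2 / 4) / t)) := by
    intro t ht
    have ht' : (0:ℝ) < t := ht
    have hpi := Real.pi_pos
    have h1 : ((2 * π * t) ^ (-(d:ℝ) / 2)) ^ 2 * (π * t) ^ ((d:ℝ) / 2) = (2 ^ d)⁻¹ * (π ^ (-(d:ℝ) / 2) * t ^ (-(d:ℝ) / 2)) := by
      rw [← Real.rpow_natCast (_ ^ _) 2, ← Real.rpow_mul (by positivity), mul_assoc 2 π t,
        Real.mul_rpow (by norm_num) (by positivity), mul_assoc, ← Real.rpow_add (by positivity),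
        ← Real.mul_rpow hpi.le ht'.le, ← Real.rpow_natCast 2 d, ← Real.rpow_neg (by norm_num)]
      congr 2 <;> push_cast <;> ring
    have h2 : t ^ (-((d:ℝ) / 2 + 1) - 1) = (t ^ 2)⁻¹ * t ^ (-(d:ℝ) / 2) := by
      rw [← Real.rpow_natCast t 2, ← Real.rpow_neg ht'.le, ← Real.rpow_add ht']; congr 1; push_cast; ring
    rw [h2]
    linear_combination (t ^ 2)⁻¹ * exp (-(‖y‖ ^ 2 / 4) / t) * (A / 4) * h1
  rw [setIntegral_congr_fun measurableSet_Ioi e, integral_const_mul, tint_val (by positivity) (by positivity)]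
  unfold cConst
  have h3 : (1 / (‖y‖ ^ 2 / 4)) ^ ((d:ℝ) / 2 + 1) = 4 * 2 ^ d * (‖y‖ ^ (d + 2))⁻¹ := by
    have : 1 / (‖y‖ ^ 2 / 4) = (2 / ‖y‖) ^ (2:ℝ) := by
      rw [show (2:ℝ) = ((2:ℕ):ℝ) by norm_num, Real.rpow_natCast]; field_simp; norm_num
    rw [this, ← Real.rpow_mul (by positivity), show (2:ℝ) * ((d:ℝ) / 2 + 1) = ((d + 2 : ℕ) : ℝ) by push_cast; ring,
      Real.rpow_natCast, div_pow, pow_add]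
    field_simp; norm_num
  rw [h3, show ((d:ℝ) + 2) / 2 = (d:ℝ) / 2 + 1 by ring]
  field_simp

lemma L_jk {d : ℕ} {j k : Fin d} (h : j ≠ k) {y : Eu d} (hy : y ≠ 0) :
    ∫ t in Set.Ioi (0:ℝ), (t ^ 2)⁻¹ * ∫ u, Lf d j k y t u = cConst d * (y j * y k / ‖y‖ ^ (d + 2)) := by
  rw [← t_val hy]
  refine setIntegral_congr_fun measurableSet_Ioi fun t ht => ?_
  have ht' : (0:ℝ) < t := ht
  simp only
  rw [Lf_val j k y ht', cross_zero h, sub_zero]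

lemma K_lim1 {d : ℕ} (hd : 1 ≤ d) {j k : Fin d} (h : j ≠ k) {m : ℕ → ZLat d} {y : Eu d} (hy : y ≠ 0)
    (hm : Tendsto (fun N : ℕ => (N:ℝ)⁻¹ • latVec (m N)) atTop (nhds y)) :
    Tendsto (fun N : ℕ => (N:ℝ) ^ d * probK d j k (m N)) atTop (nhds (cConst d * (y j * y k / ‖y‖ ^ (d + 2)))) := by
  rw [← L_jk h hy]
  exact (probK_lim hd j k hy hm).1

lemma K_lim2 {d : ℕ} (hd : 1 ≤ d) {j k : Fin d} {m : ℕ → ZLat d} {y : Eu d} (hy : y ≠ 0)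
    (hm : Tendsto (fun N : ℕ => (N:ℝ)⁻¹ • latVec (m N)) atTop (nhds y)) :
    Tendsto (fun N : ℕ => (N:ℝ) ^ d * (probK d j j (m N) - probK d k k (m N))) atTop
      (nhds (cConst d * ((y j ^ 2 - y k ^ 2) / ‖y‖ ^ (d + 2)))) := by
  obtain ⟨h1, i1⟩ := probK_lim hd j j hy hm
  obtain ⟨h2, i2⟩ := probK_lim hd k k hy hm
  have := h1.sub h2
  rw [← integral_sub i1 i2] at this
  simp only [← mul_sub] at this
  convert this using 2
  rw [← t_val hy]
  refine setIntegral_congr_fun measurableSet_Ioi fun t ht => ?_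
  have ht' : (0:ℝ) < t := ht
  simp only
  rw [Lf_val j j y ht', Lf_val k k y ht', sq_swap j k]
  ring

/-- Dominating radial function. -/
def rad (d : ℕ) (R : ℝ) (y : Eu d) : ℝ := if ‖y‖ ≤ R then (‖y‖ ^ (d - 1))⁻¹ else 0

lemma rad_int {d : ℕ} (hd : 1 ≤ d) (R : ℝ) : Integrable (rad d R) := by
  have : Nonempty (Fin d) := ⟨⟨0, hd⟩⟩
  have : Nontrivial (Eu d) := inferInstance
  have := (integrable_fun_norm_addHaar (E := Eu d) volume
    (f := fun r : ℝ => if r ≤ R then (r ^ (d - 1))⁻¹ else 0)).2 ?_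
  · exact this
  · simp only [finrank_euclideanSpace, Fintype.card_fin, smul_eq_mul]
    have h1 : IntegrableOn (fun _ : ℝ => (1:ℝ)) (Set.Iic R) (volume.restrict (Set.Ioi 0)) := by
      rw [IntegrableOn, Measure.restrict_restrict measurableSet_Iic]
      refine integrableOn_const (hs := ?_)
      refine ((measure_mono ?_).trans_lt (measure_Icc_lt_top (a := 0) (b := R))).ne
      intro x hx; exact ⟨le_of_lt hx.2, hx.1⟩
    have h2 := (integrable_indicator_iff measurableSet_Iic).2 h1
    refine IntegrableOn.congr_fun h2 (fun r hr => ?_) measurableSet_Ioi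
    have hr' : (0:ℝ) < r := hr
    simp only [Set.indicator, Set.mem_Iic]
    split_ifs
    · rw [mul_inv_cancel₀ (by positivity)]
    · rw [mul_zero]

lemma rad_nonneg {d : ℕ} (R : ℝ) (y : Eu d) : 0 ≤ rad d R y := by
  unfold rad; split_ifs <;> positivity

/-- Antisymmetrized integrand. -/
def Df {d : ℕ} (σ : Eu d ≃ₗᵢ[ℝ] Eu d) (F : Eu d → ℝ) (x y : Eu d) : ℝ := F (x - y) - F (x - σ y)

lemma Df_le {d : ℕ} (σ : Eu d ≃ₗᵢ[ℝ] Eu d) {F : Eu d → ℝ} {Λ : ℝ} (hΛ : 0 ≤ Λ)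
    (hF : ∀ a b, |F a - F b| ≤ Λ * ‖a - b‖) (x y : Eu d) : |Df σ F x y| ≤ 2 * Λ * ‖y‖ := by
  refine (hF _ _).trans ?_
  have : ‖x - y - (x - σ y)‖ ≤ 2 * ‖y‖ := by
    rw [show x - y - (x - σ y) = σ y - y by abel]
    refine (norm_sub_le _ _).trans ?_
    rw [LinearIsometryEquiv.norm_map]; linarith
  nlinarith

lemma Df_zero {d : ℕ} (σ : Eu d ≃ₗᵢ[ℝ] Eu d) {F : Eu d → ℝ} {ρ : ℝ}
    (hρ : ∀ a, ρ < ‖a‖ → F a = 0) (x y : Eu d) (h : ρ + ‖x‖ < ‖y‖) : Df σ F x y = 0 := by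
  have h1 := norm_sub_norm_le y x
  have h2 := norm_sub_norm_le (σ y) x
  rw [LinearIsometryEquiv.norm_map] at h2
  rw [norm_sub_rev] at h1 h2
  rw [Df, hρ _ (by linarith), hρ _ (by linarith), sub_zero]

lemma cont_bound {d : ℕ} (hd : 1 ≤ d) (σ : Eu d ≃ₗᵢ[ℝ] Eu d) {F : Eu d → ℝ} {Λ ρ C : ℝ} (hΛ : 0 ≤ Λ)
    (hF : ∀ a b, |F a - F b| ≤ Λ * ‖a - b‖) (hρ : ∀ a, ρ < ‖a‖ → F a = 0)
    {K : Eu d → ℝ} (hK : ∀ y, |K y| ≤ C * (‖y‖ ^ d)⁻¹) (x y : Eu d) :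
    |K y * Df σ F x y| ≤ C * (2 * Λ) * rad d (ρ + ‖x‖) y := by
  by_cases h : ρ + ‖x‖ < ‖y‖
  · rw [Df_zero σ hρ x y h, rad, if_neg (not_le.2 h)]; simp
  · rw [rad, if_pos (not_lt.1 h), abs_mul]
    by_cases h0 : y = 0
    · subst h0
      have := Df_le σ hΛ hF x 0
      rw [norm_zero, mul_zero] at this
      have h3 : |Df σ F x 0| = 0 := le_antisymm this (abs_nonneg _)
      have hC : 0 ≤ C := by
        obtain ⟨i⟩ : Nonempty (Fin d) := ⟨⟨0, hd⟩⟩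
        have := (abs_nonneg _).trans (hK (EuclideanSpace.single i 1))
        simpa using this
      rw [h3, mul_zero]; positivity
    · have hy : 0 < ‖y‖ := norm_pos_iff.2 h0
      calc |K y| * |Df σ F x y| ≤ C * (‖y‖ ^ d)⁻¹ * (2 * Λ * ‖y‖) :=
            mul_le_mul (hK y) (Df_le σ hΛ hF x y) (abs_nonneg _) ((abs_nonneg _).trans (hK y))
        _ = _ := by
          obtain ⟨e, rfl⟩ : ∃ e, d = e + 1 := ⟨d - 1, by omega⟩
          simp only [Nat.add_sub_cancel]
          rw [pow_succ]; field_simp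

lemma Df_cont {d : ℕ} (σ : Eu d ≃ₗᵢ[ℝ] Eu d) {F : Eu d → ℝ} (hFc : Continuous F) :
    Continuous (fun q : Eu d × Eu d => Df σ F q.1 q.2) := by
  unfold Df
  have := σ.continuous
  fun_prop

lemma pv_lim {d : ℕ} (hd : 1 ≤ d) (σ : Eu d ≃ₗᵢ[ℝ] Eu d) {F : Eu d → ℝ} (hFc : Continuous F)
    (hFs : HasCompactSupport F) {Λ ρ C : ℝ} (hΛ : 0 ≤ Λ)
    (hF : ∀ a b, |F a - F b| ≤ Λ * ‖a - b‖) (hρ : ∀ a, ρ < ‖a‖ → F a = 0)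
    {K : Eu d → ℝ} (hKm : Measurable K) (hK : ∀ y, |K y| ≤ C * (‖y‖ ^ d)⁻¹) (hKσ : ∀ y, K (σ y) = - K y)
    (x : Eu d) :
    Tendsto (fun r : ℝ => ∫ y in {y : Eu d | r < ‖y‖}, K y * F (x - y)) (nhdsWithin 0 (Set.Ioi 0))
      (nhds (2⁻¹ * ∫ y, K y * Df σ F x y)) := by
  have hms : ∀ r : ℝ, MeasurableSet {y : Eu d | r < ‖y‖} := fun r => measurableSet_lt measurable_const measurable_norm
  have hDm : Measurable (fun y => Df σ F x y) :=
    ((Df_cont σ hFc).comp (continuous_const.prodMk continuous_id)).measurable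
  have hDi : Tendsto (fun r : ℝ => ∫ y, Set.indicator {y : Eu d | r < ‖y‖} (fun y => K y * Df σ F x y) y)
      (nhdsWithin 0 (Set.Ioi 0)) (nhds (∫ y, K y * Df σ F x y)) := by
    refine tendsto_integral_filter_of_dominated_convergence (fun y => C * (2 * Λ) * rad d (ρ + ‖x‖) y) ?_ ?_
      ((rad_int hd _).const_mul _) ?_
    · refine Eventually.of_forall fun r => ?_
      exact ((hKm.mul hDm).indicator (hms r)).aestronglyMeasurable
    · refine Eventually.of_forall fun r => Eventually.of_forall fun y => ?_
      refine (norm_indicator_le_norm_self _ _).trans ?_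
      exact cont_bound hd σ hΛ hF hρ hK x y
    · have : ∀ᵐ y : Eu d, y ≠ 0 := by
        have : Nonempty (Fin d) := ⟨⟨0, hd⟩⟩
        have : Nontrivial (Eu d) := inferInstance
        exact Measure.ae_ne volume 0
      filter_upwards [this] with y hy
      have hy : 0 < ‖y‖ := norm_pos_iff.2 hy
      refine tendsto_const_nhds.congr' ?_
      filter_upwards [mem_nhdsWithin_of_mem_nhds (Iio_mem_nhds hy)] with r hr
      rw [Set.indicator_of_mem]
      exact hr
  refine (hDi.const_mul 2⁻¹).congr' ?_
  filter_upwards [self_mem_nhdsWithin] with r hr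
  have hr : 0 < r := hr
  have hi : ∀ g : Eu d → Eu d, Continuous g → HasCompactSupport (fun y => F (g y)) →
      IntegrableOn (fun y => K y * F (g y)) {y : Eu d | r < ‖y‖} := by
    intro g hg hgc
    have hI : Integrable (fun y => F (g y)) := (hFc.comp hg).integrable_of_hasCompactSupport hgc
    refine Integrable.mono' ((hI.norm.const_mul (C * (r ^ d)⁻¹)).integrableOn)
      ((hKm.mul (hFc.comp hg).measurable).aestronglyMeasurable) ?_
    refine (ae_restrict_iff' (hms r)).2 (Eventually.of_forall fun y hy => ?_)
    have hy : r < ‖y‖ := hy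
    have hC : 0 ≤ C := by
      have h1 := (abs_nonneg _).trans (hK y)
      have : 0 < (‖y‖ ^ d)⁻¹ := by have := hr.trans hy; positivity
      exact nonneg_of_mul_nonneg_left h1 this
    rw [norm_mul]
    refine mul_le_mul_of_nonneg_right ((hK y).trans ?_) (norm_nonneg _)
    gcongr
  have hc1 : HasCompactSupport (fun y => F (x - y)) := hFs.comp_homeomorph (Homeomorph.subLeft x)
  have hc2 : HasCompactSupport (fun y => F (x - σ y)) :=
    hFs.comp_homeomorph (σ.toHomeomorph.trans (Homeomorph.subLeft x))
  have i1 := hi (fun y => x - y) (by fun_prop) hc1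
  have i2 := hi (fun y => x - σ y) (by have := σ.continuous; fun_prop) hc2
  rw [integral_indicator (hms r)]
  have e : ∫ y in {y : Eu d | r < ‖y‖}, K y * F (x - y) = - ∫ y in {y : Eu d | r < ‖y‖}, K y * F (x - σ y) := by
    rw [← integral_neg, ← integral_indicator (hms r), ← integral_indicator (hms r),
      ← (LinearIsometryEquiv.measurePreserving σ).integral_comp σ.toHomeomorph.measurableEmbedding]
    congr 1; ext y
    simp only [Set.indicator, Set.mem_ofPred_eq, LinearIsometryEquiv.norm_map, hKσ, neg_mul]
  have e2 : ∫ y in {y : Eu d | r < ‖y‖}, K y * Df σ F x y =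
      (∫ y in {y : Eu d | r < ‖y‖}, K y * F (x - y)) - ∫ y in {y : Eu d | r < ‖y‖}, K y * F (x - σ y) := by
    rw [← integral_sub i1 i2]
    simp only [Df, mul_sub]
  rw [e2]; linarith

lemma lat_fin {d : ℕ} {N : ℝ} (hN : 0 < N) (R : ℝ) : {m : ZLat d | ‖N⁻¹ • latVec m‖ ≤ R}.Finite := by
  refine (Set.finite_Icc (fun _ : Fin d => -⌈N * R⌉) (fun _ => ⌈N * R⌉)).subset fun m hm => ?_
  have hm : ‖N⁻¹ • latVec m‖ ≤ R := hm
  rw [norm_smul, norm_inv, Real.norm_of_nonneg hN.le, inv_mul_le_iff₀ hN] at hm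
  have h : ∀ i, |m i| ≤ ⌈N * R⌉ := by
    intro i
    have h1 := (PiLp.norm_apply_le (latVec m) i).trans (hm.trans (Int.le_ceil _))
    rw [latVec_apply, Real.norm_eq_abs] at h1
    exact_mod_cast h1
  exact ⟨fun i => (abs_le.1 (h i)).1, fun i => (abs_le.1 (h i)).2⟩

lemma fin_summable {d : ℕ} {N : ℝ} (hN : 0 < N) (R : ℝ) (g : ZLat d → ℝ)
    (hg : ∀ m, R < ‖N⁻¹ • latVec m‖ → g m = 0) : Summable g := by
  refine summable_of_hasFiniteSupport ((lat_fin hN R).subset fun m hm => ?_)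
  by_contra h
  exact hm (hg m (not_le.1 h))

/-- Discretized operator. -/
def TN {d : ℕ} (κ : ZLat d → ℝ) (F : Eu d → ℝ) (N : ℝ) (n : ZLat d) : ℝ :=
  ∑' m, κ (n - m) * F (N⁻¹ • latVec m)

lemma TN_eq {d : ℕ} (σ : Eu d ≃ₗᵢ[ℝ] Eu d) (τ : ZLat d ≃ ZLat d) (hτ : ∀ n, latVec (τ n) = σ (latVec n))
    {κ : ZLat d → ℝ} (hκτ : ∀ m, κ (τ m) = - κ m) {F : Eu d → ℝ} {ρ : ℝ} (hρ : ∀ a, ρ < ‖a‖ → F a = 0)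
    {N : ℝ} (hN : 0 < N) (n : ZLat d) :
    TN κ F N n = 2⁻¹ * ∑' m, κ m * Df σ F (N⁻¹ • latVec n) (N⁻¹ • latVec m) := by
  have e1 : TN κ F N n = ∑' m, κ m * F (N⁻¹ • latVec n - N⁻¹ • latVec m) := by
    unfold TN
    rw [← Equiv.tsum_eq (Equiv.subLeft n)]
    simp only [Equiv.subLeft_apply, sub_sub_cancel, latVec_sub, smul_sub]
  have e2 : TN κ F N n = - ∑' m, κ m * F (N⁻¹ • latVec n - σ (N⁻¹ • latVec m)) := by
    rw [e1, ← Equiv.tsum_eq τ, ← tsum_neg]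
    simp only [hκτ, hτ, map_smul, neg_mul]
  set x := N⁻¹ • latVec n
  have s1 : Summable (fun m => κ m * F (x - N⁻¹ • latVec m)) := by
    refine fin_summable hN (ρ + ‖x‖) _ fun m hm => ?_
    have h1 := norm_sub_norm_le (N⁻¹ • latVec m) x
    rw [norm_sub_rev] at h1
    rw [hρ _ (by linarith), mul_zero]
  have s2 : Summable (fun m => κ m * F (x - σ (N⁻¹ • latVec m))) := by
    refine fin_summable hN (ρ + ‖x‖) _ fun m hm => ?_
    have h1 := norm_sub_norm_le (σ (N⁻¹ • latVec m)) x
    rw [norm_sub_rev, LinearIsometryEquiv.norm_map] at h1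
    rw [hρ _ (by linarith), mul_zero]
  have e3 : ∑' m, κ m * Df σ F x (N⁻¹ • latVec m) =
      (∑' m, κ m * F (x - N⁻¹ • latVec m)) - ∑' m, κ m * F (x - σ (N⁻¹ • latVec m)) := by
    rw [← s1.tsum_sub s2]; simp only [Df, mul_sub]
  rw [e3]; linarith

lemma disc_bound {d : ℕ} (hd : 1 ≤ d) (σ : Eu d ≃ₗᵢ[ℝ] Eu d) {F : Eu d → ℝ} {Λ ρ C : ℝ} (hΛ : 0 ≤ Λ)
    (hC : 0 ≤ C)
    (hF : ∀ a b, |F a - F b| ≤ Λ * ‖a - b‖) (hρ : ∀ a, ρ < ‖a‖ → F a = 0)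
    {κ : ZLat d → ℝ} (hκ : ∀ m, m ≠ 0 → ‖latVec m‖ ^ d * |κ m| ≤ C) {N : ℝ} (hN : 1 ≤ N) (x y : Eu d) :
    |N ^ d * (κ (flr (N • y)) * Df σ F (N⁻¹ • latVec (flr (N • x))) (N⁻¹ • latVec (flr (N • y))))| ≤
      C * (2 * Λ) * (1 + √d) ^ (d - 1) * rad d (ρ + ‖x‖ + 2 * √d) y := by
  have hN0 : 0 < N := by linarith
  have hR : 0 ≤ C * (2 * Λ) * (1 + √d) ^ (d - 1) * rad d (ρ + ‖x‖ + 2 * √d) y :=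
    mul_nonneg (by positivity) (rad_nonneg _ _)
  set m := flr (N • y) with hm
  set x' := N⁻¹ • latVec (flr (N • x)) with hx'
  set y' := N⁻¹ • latVec m with hy'
  by_cases h0 : Df σ F x' y' = 0
  · rw [h0, mul_zero, mul_zero, abs_zero]; exact hR
  have hsd : √(d:ℝ) / N ≤ √d := div_le_self (Real.sqrt_nonneg _) hN
  have hxx : ‖x'‖ ≤ ‖x‖ + √d := by
    have h1 := norm_sub_flr_scale N hN0 x
    have h2 := norm_sub_norm_le x' x
    rw [norm_sub_rev] at h2
    rw [← hx'] at h1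
    linarith
  have hyy : ‖y‖ ≤ ‖y'‖ + √d / N := by
    have h1 := norm_sub_flr_scale N hN0 y
    have h2 := norm_sub_norm_le y y'
    linarith
  have hsupp : ‖y‖ ≤ ρ + ‖x‖ + 2 * √d := by
    by_contra hh
    exact h0 (Df_zero σ hρ x' y' (by linarith [not_le.1 hh]))
  have hm0 : m ≠ 0 := by
    intro h
    have : y' = 0 := by rw [hy', h, latVec_zero, smul_zero]
    exact h0 (by rw [this]; simp [Df])
  have hy'n : ‖y'‖ = ‖latVec m‖ / N := by
    rw [hy', norm_smul, norm_inv, Real.norm_of_nonneg hN0.le, div_eq_inv_mul]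
  have h1m := one_le_norm_latVec m hm0
  have hy0 : 0 < ‖y'‖ := by rw [hy'n]; positivity
  have hyle : ‖y‖ ≤ (1 + √d) * ‖y'‖ := by
    have : √(d:ℝ) / N ≤ √d * ‖y'‖ := by
      rw [hy'n, ← mul_div_assoc]
      gcongr
      exact le_mul_of_one_le_right (Real.sqrt_nonneg _) h1m
    linarith
  rw [rad, if_pos hsupp]
  have hκ' : N ^ d * |κ m| ≤ C * (‖y'‖ ^ d)⁻¹ := by
    have := hκ m hm0
    rw [show ‖latVec m‖ = N * ‖y'‖ by rw [hy'n]; field_simp, mul_pow] at this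
    rw [← div_eq_mul_inv, le_div_iff₀ (by positivity)]
    linarith
  have hyinv : (‖y'‖ ^ (d - 1))⁻¹ ≤ (1 + √d) ^ (d - 1) * (‖y‖ ^ (d - 1))⁻¹ := by
    by_cases hyz : ‖y‖ = 0
    · by_cases hd1 : d - 1 = 0
      · rw [hd1]; simp
      · exfalso
        have hy00 : y = 0 := norm_eq_zero.1 hyz
        apply hm0
        rw [hm, hy00, smul_zero]
        ext i; simp [flr]
    · have hyp : 0 < ‖y‖ := lt_of_le_of_ne (norm_nonneg _) (Ne.symm hyz)
      rw [← div_eq_mul_inv, le_div_iff₀ (by positivity), inv_mul_le_iff₀ (by positivity), mul_comm, ← mul_pow]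
      gcongr
  rw [abs_mul, abs_mul, abs_of_nonneg (show 0 ≤ N ^ d by positivity), ← mul_assoc]
  calc N ^ d * |κ m| * |Df σ F x' y'| ≤ C * (‖y'‖ ^ d)⁻¹ * (2 * Λ * ‖y'‖) :=
        mul_le_mul hκ' (Df_le σ hΛ hF x' y') (abs_nonneg _) (by positivity)
    _ = C * (2 * Λ) * (‖y'‖ ^ (d - 1))⁻¹ := by
      obtain ⟨e, rfl⟩ : ∃ e, d = e + 1 := ⟨d - 1, by omega⟩
      simp only [Nat.add_sub_cancel]
      rw [pow_succ]; field_simp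
    _ ≤ C * (2 * Λ) * ((1 + √d) ^ (d - 1) * (‖y‖ ^ (d - 1))⁻¹) := by gcongr
    _ = _ := by ring

lemma Df_tend {d : ℕ} (σ : Eu d ≃ₗᵢ[ℝ] Eu d) {F : Eu d → ℝ} (hFc : Continuous F) {a b : ℕ → Eu d} {x y : Eu d}
    (ha : Tendsto a atTop (nhds x)) (hb : Tendsto b atTop (nhds y)) :
    Tendsto (fun N => Df σ F (a N) (b N)) atTop (nhds (Df σ F x y)) :=
  ((Df_cont σ hFc).tendsto (x, y)).comp (ha.prodMk_nhds hb)

lemma TN_lim {d : ℕ} (hd : 1 ≤ d) (σ : Eu d ≃ₗᵢ[ℝ] Eu d) (τ : ZLat d ≃ ZLat d)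
    (hτ : ∀ n, latVec (τ n) = σ (latVec n)) {F : Eu d → ℝ} (hFc : Continuous F)
    {Λ ρ C : ℝ} (hΛ : 0 ≤ Λ) (hC : 0 ≤ C)
    (hF : ∀ a b, |F a - F b| ≤ Λ * ‖a - b‖) (hρ : ∀ a, ρ < ‖a‖ → F a = 0)
    {κ : ZLat d → ℝ} (hκτ : ∀ m, κ (τ m) = - κ m) (hκ : ∀ m, m ≠ 0 → ‖latVec m‖ ^ d * |κ m| ≤ C)
    {K : Eu d → ℝ}
    (hlim : ∀ (m : ℕ → ZLat d) (y : Eu d), y ≠ 0 →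
      Tendsto (fun N : ℕ => (N:ℝ)⁻¹ • latVec (m N)) atTop (nhds y) →
      Tendsto (fun N : ℕ => (N:ℝ) ^ d * κ (m N)) atTop (nhds (K y))) (x : Eu d) :
    Tendsto (fun N : ℕ => TN κ F N (flr ((N:ℝ) • x))) atTop (nhds (2⁻¹ * ∫ y, K y * Df σ F x y)) := by
  have main : Tendsto (fun N : ℕ => ∫ y, (N:ℝ) ^ d * (κ (flr ((N:ℝ) • y)) *
      Df σ F ((N:ℝ)⁻¹ • latVec (flr ((N:ℝ) • x))) ((N:ℝ)⁻¹ • latVec (flr ((N:ℝ) • y))))) atTop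
      (nhds (∫ y, K y * Df σ F x y)) := by
    refine tendsto_integral_filter_of_dominated_convergence
      (fun y => C * (2 * Λ) * (1 + √d) ^ (d - 1) * rad d (ρ + ‖x‖ + 2 * √d) y) ?_ ?_
      ((rad_int hd _).const_mul _) ?_
    · refine Eventually.of_forall fun N => ?_
      have h : Measurable (fun y : Eu d => flr ((N:ℝ) • y)) :=
        flr_meas.comp (by fun_prop)
      exact ((measurable_of_countable (fun m : ZLat d => (N:ℝ) ^ d * (κ m *
        Df σ F ((N:ℝ)⁻¹ • latVec (flr ((N:ℝ) • x))) ((N:ℝ)⁻¹ • latVec m)))).comp h).aestronglyMeasurable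
    · filter_upwards [eventually_ge_atTop 1] with N hN
      refine Eventually.of_forall fun y => ?_
      exact disc_bound hd σ hΛ hC hF hρ hκ (by exact_mod_cast hN) x y
    · have : ∀ᵐ y : Eu d, y ≠ 0 := by
        have : Nonempty (Fin d) := ⟨⟨0, hd⟩⟩
        have : Nontrivial (Eu d) := inferInstance
        exact Measure.ae_ne volume 0
      filter_upwards [this] with y hy
      have h1 := hlim (fun N => flr ((N:ℝ) • y)) y hy (flr_scale_tendsto y)
      have h2 : Tendsto (fun N : ℕ => Df σ F ((N:ℝ)⁻¹ • latVec (flr ((N:ℝ) • x))) ((N:ℝ)⁻¹ • latVec (flr ((N:ℝ) • y))))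
          atTop (nhds (Df σ F x y)) :=
        Df_tend σ hFc (flr_scale_tendsto x) (flr_scale_tendsto y)
      refine (h1.mul h2).congr fun N => ?_
      ring
  refine (main.const_mul 2⁻¹).congr' ?_
  filter_upwards [eventually_ge_atTop 1] with N hN
  have hN' : (0:ℝ) < N := by exact_mod_cast hN
  rw [TN_eq σ τ hτ hκτ hρ hN', tsum_eq_flr_scale _ (N:ℝ) hN', integral_const_mul ((N:ℝ) ^ d)]

lemma kappa_summable {d : ℕ} (hd : 1 ≤ d) {p : ℝ} (hp : 1 < p) {κ : ZLat d → ℝ} {C : ℝ}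
    (hκ : ∀ m, m ≠ 0 → ‖latVec m‖ ^ d * |κ m| ≤ C) : Summable (fun m => |κ m| ^ p) := by
  have hd' : (1:ℝ) ≤ d := by exact_mod_cast hd
  have hp0 : 0 < p := by linarith
  have hC0 : 0 ≤ C := by
    have h := hκ (fun _ => 1) (by
      intro h; have := congrFun h ⟨0, hd⟩; simp at this)
    exact (by positivity : (0:ℝ) ≤ _).trans h
  set C1 := max C |κ 0| * (2 * (1 + √d)) ^ d with hC1
  have hC1n : 0 ≤ C1 := by positivity
  have key : ∀ y : Eu d, |κ (flr y)| ≤ C1 * (1 + ‖y‖) ^ (-(d:ℝ)) := by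
    intro y
    set m := flr y with hm
    have h1 : ‖y‖ ≤ ‖latVec m‖ + √d := by
      have := norm_sub_norm_le y (latVec m)
      have h2 := norm_sub_flr' y
      rw [← hm] at h2
      linarith
    rw [Real.rpow_neg (by positivity), Real.rpow_natCast, ← div_eq_mul_inv, le_div_iff₀ (by positivity)]
    have hs := Real.sqrt_nonneg (d:ℝ)
    by_cases hm0 : m = 0
    · rw [hm0, latVec_zero, norm_zero] at h1
      rw [hm0, hC1]
      gcongr
      · exact le_max_right _ _
      · linarith
    · have h2 := one_le_norm_latVec m hm0
      have h3 : 1 + ‖y‖ ≤ 2 * (1 + √d) * ‖latVec m‖ := by nlinarith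
      calc |κ m| * (1 + ‖y‖) ^ d ≤ |κ m| * (2 * (1 + √d) * ‖latVec m‖) ^ d := by gcongr
        _ = (‖latVec m‖ ^ d * |κ m|) * (2 * (1 + √d)) ^ d := by rw [mul_pow]; ring
        _ ≤ C * (2 * (1 + √d)) ^ d := by gcongr; exact hκ m hm0
        _ ≤ _ := by rw [hC1]; gcongr; exact le_max_left _ _
  rw [summable_iff_flr]
  have hint : Integrable (fun y : Eu d => (1 + ‖y‖) ^ (-((d:ℝ) * p))) :=
    integrable_one_add_norm (by simp only [finrank_euclideanSpace, Fintype.card_fin]; nlinarith)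
  refine Integrable.mono' (hint.const_mul (C1 ^ p)) ?_ (Eventually.of_forall fun y => ?_)
  · exact ((measurable_of_countable (fun m : ZLat d => |κ m| ^ p)).comp flr_meas).aestronglyMeasurable
  · rw [Real.norm_of_nonneg (by positivity)]
    calc |κ (flr y)| ^ p ≤ (C1 * (1 + ‖y‖) ^ (-(d:ℝ))) ^ p := by gcongr; exact key y
      _ = _ := by
        rw [Real.mul_rpow hC1n (by positivity), ← Real.rpow_mul (by positivity), neg_mul]

lemma TN_summable {d : ℕ} (hd : 1 ≤ d) {p : ℝ} (hp : 1 < p) {κ : ZLat d → ℝ} {C : ℝ}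
    (hκ : ∀ m, m ≠ 0 → ‖latVec m‖ ^ d * |κ m| ≤ C) {F : Eu d → ℝ} {ρ : ℝ} (hρ : ∀ a, ρ < ‖a‖ → F a = 0)
    {N : ℝ} (hN : 0 < N) : Summable (fun n => |TN κ F N n| ^ p) := by
  have hs := kappa_summable hd hp hκ
  have hp0 : 0 < p := by linarith
  have hpt : (ENNReal.ofReal p).toReal = p := ENNReal.toReal_ofReal hp0.le
  have e : ∀ n, TN κ F N n = ∑ m ∈ (lat_fin (d := d) hN ρ).toFinset, F (N⁻¹ • latVec m) * κ (n - m) := by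
    intro n
    unfold TN
    rw [tsum_eq_sum (s := (lat_fin (d := d) hN ρ).toFinset)]
    · exact Finset.sum_congr rfl fun m _ => mul_comm _ _
    · intro m hm
      rw [Set.Finite.mem_toFinset] at hm
      have : ρ < ‖N⁻¹ • latVec m‖ := not_le.1 hm
      rw [hρ _ this, mul_zero]
  have h1 : ∀ m : ZLat d, Memℓp (fun n => F (N⁻¹ • latVec m) * κ (n - m)) (ENNReal.ofReal p) := by
    intro m
    refine Memℓp.const_mul ?_ _
    rw [memℓp_gen_iff (by rw [hpt]; exact hp0), hpt]
    exact (Equiv.summable_iff (Equiv.subRight m)).2 hs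
  have h2 : Memℓp (fun n => ∑ m ∈ (lat_fin (d := d) hN ρ).toFinset, F (N⁻¹ • latVec m) * κ (n - m)) (ENNReal.ofReal p) :=
    Memℓp.finsetSum _ fun m _ => h1 m
  rw [memℓp_gen_iff (by rw [hpt]; exact hp0), hpt] at h2
  simp only [e]
  exact h2

lemma F_lim {d : ℕ} {p : ℝ} (hp : 1 < p) {F : Eu d → ℝ} (hFc : Continuous F) {B ρ : ℝ}
    (hB : ∀ a, |F a| ≤ B) (hρ : ∀ a, ρ < ‖a‖ → F a = 0) :
    Tendsto (fun N : ℕ => ∫ x, |F ((N:ℝ)⁻¹ • latVec (flr ((N:ℝ) • x)))| ^ p) atTop (nhds (∫ x, |F x| ^ p)) := by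
  have hp0 : 0 < p := by linarith
  have hB0 : 0 ≤ B := (abs_nonneg _).trans (hB 0)
  have hc : Continuous (fun x => |F x| ^ p) := by
    refine (hFc.abs).rpow_const fun x => Or.inr hp0.le
  refine tendsto_integral_filter_of_dominated_convergence
    (Set.indicator (Metric.closedBall (0 : Eu d) (ρ + √d)) (fun _ => B ^ p)) ?_ ?_ ?_ ?_
  · exact Eventually.of_forall fun N => (hc.measurable.comp (scale_meas (N:ℝ))).aestronglyMeasurable
  · filter_upwards [eventually_ge_atTop 1] with N hN
    refine Eventually.of_forall fun x => ?_
    have hN' : (1:ℝ) ≤ N := by exact_mod_cast hN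
    rw [Real.norm_of_nonneg (by positivity)]
    by_cases hx : x ∈ Metric.closedBall (0 : Eu d) (ρ + √d)
    · rw [Set.indicator_of_mem hx]
      gcongr
      exact hB _
    · rw [Set.indicator_of_notMem hx]
      have h1 := norm_sub_flr_scale (N:ℝ) (by positivity) x
      have h2 := norm_sub_norm_le x ((N:ℝ)⁻¹ • latVec (flr ((N:ℝ) • x)))
      have hsd : √(d:ℝ) / N ≤ √d := div_le_self (Real.sqrt_nonneg _) hN'
      rw [mem_closedBall_zero_iff, not_le] at hx
      rw [hρ _ (by linarith), abs_zero, Real.zero_rpow hp0.ne']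
  · rw [integrable_indicator_iff measurableSet_closedBall]
    exact integrableOn_const (hs := measure_closedBall_lt_top.ne)
  · exact Eventually.of_forall fun x => (hc.tendsto x).comp (flr_scale_tendsto x)

lemma transfer {d : ℕ} (hd : 1 ≤ d) {p : ℝ} (hp : 1 < p) (σ : Eu d ≃ₗᵢ[ℝ] Eu d) (τ : ZLat d ≃ ZLat d)
    (hτ : ∀ n, latVec (τ n) = σ (latVec n)) {F : Eu d → ℝ} (hF : ContDiff ℝ (⊤ : ℕ∞) F)
    (hFs : HasCompactSupport F)
    {C : ℝ} (hC : 0 ≤ C)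
    {κ : ZLat d → ℝ} (hκτ : ∀ m, κ (τ m) = - κ m) (hκ : ∀ m, m ≠ 0 → ‖latVec m‖ ^ d * |κ m| ≤ C)
    {K : Eu d → ℝ} (hKm : Measurable K) {C' : ℝ} (hK : ∀ y, |K y| ≤ C' * (‖y‖ ^ d)⁻¹) (hKσ : ∀ y, K (σ y) = - K y)
    (hlim : ∀ (m : ℕ → ZLat d) (y : Eu d), y ≠ 0 →
      Tendsto (fun N : ℕ => (N:ℝ)⁻¹ • latVec (m N)) atTop (nhds y) →
      Tendsto (fun N : ℕ => (N:ℝ) ^ d * κ (m N)) atTop (nhds (K y)))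
    {M : ℝ} (hM : 0 ≤ M)
    (hop : ∀ N : ℝ, 0 < N → lpN d p (TN κ F N) ≤ M * lpN d p (fun m => F (N⁻¹ • latVec m))) :
    ∃ RF : Eu d → ℝ,
      (∀ x : Eu d, Tendsto (fun r : ℝ => ∫ y in {y : Eu d | r < ‖y‖}, K y * F (x - y))
        (nhdsWithin 0 (Set.Ioi 0)) (nhds (RF x))) ∧
      (∫ x : Eu d, |RF x| ^ p) ^ (1 / p) ≤ M * (∫ x : Eu d, |F x| ^ p) ^ (1 / p) := by
  have hp0 : 0 < p := by linarith
  have hFc := hF.continuous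
  obtain ⟨Λ, hΛ⟩ := ContDiff.lipschitzWith_of_hasCompactSupport hFs hF (by simp)
  have hΛ' : ∀ a b, |F a - F b| ≤ (Λ:ℝ) * ‖a - b‖ := fun a b => by
    have := hΛ.dist_le_mul a b
    rwa [Real.dist_eq, dist_eq_norm] at this
  obtain ⟨B, hB⟩ := hFs.exists_bound_of_continuous hFc
  obtain ⟨ρ, hρ0⟩ := hFs.isCompact.isBounded.subset_closedBall 0
  have hρ : ∀ a, ρ < ‖a‖ → F a = 0 := by
    intro a ha
    by_contra h
    have := hρ0 (subset_tsupport F h)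
    rw [mem_closedBall_zero_iff] at this
    linarith
  set RF : Eu d → ℝ := fun x => 2⁻¹ * ∫ y, K y * Df σ F x y with hRF
  have hTN : ∀ x, Tendsto (fun N : ℕ => TN κ F N (flr ((N:ℝ) • x))) atTop (nhds (RF x)) :=
    fun x => TN_lim hd σ τ hτ hFc Λ.2 hC hΛ' hρ hκτ hκ hlim x
  refine ⟨RF, fun x => pv_lim hd σ hFc hFs Λ.2 hΛ' hρ hKm hK hKσ x, ?_⟩
  have gm : ∀ N : ℕ, Measurable (fun x : Eu d => |TN κ F N (flr ((N:ℝ) • x))| ^ p) := fun N => by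
    have h : Measurable (fun y : Eu d => flr ((N:ℝ) • y)) := flr_meas.comp (by fun_prop)
    exact (measurable_of_countable (fun n : ZLat d => |TN κ F N n| ^ p)).comp h
  have hpt : ∀ x, Tendsto (fun N : ℕ => |TN κ F N (flr ((N:ℝ) • x))| ^ p) atTop (nhds (|RF x| ^ p)) := fun x =>
    (hTN x).abs.rpow_const (Or.inr hp0.le)
  have bnd : ∀ N : ℕ, 1 ≤ N → ∫⁻ x : Eu d, ENNReal.ofReal (|TN κ F N (flr ((N:ℝ) • x))| ^ p) ≤
      ENNReal.ofReal (M ^ p * ∫ x, |F ((N:ℝ)⁻¹ • latVec (flr ((N:ℝ) • x)))| ^ p) := by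
    intro N hN
    have hN' : (0:ℝ) < N := by exact_mod_cast hN
    have hsum := TN_summable hd hp hκ hρ hN'
    have hint : Integrable (fun x : Eu d => |TN κ F N (flr ((N:ℝ) • x))| ^ p) :=
      (integrable_comp_smul_iff volume (fun x : Eu d => |TN κ F N (flr x)| ^ p) hN'.ne').2
        ((summable_iff_flr _).1 hsum)
    rw [← ofReal_integral_eq_lintegral_ofReal hint (Eventually.of_forall fun x => by positivity)]
    refine ENNReal.ofReal_le_ofReal ?_
    have h1 := hop N hN'
    unfold lpN at h1
    have hA : 0 ≤ ∑' n, |TN κ F N n| ^ p := tsum_nonneg fun n => by positivity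
    have hBn : 0 ≤ ∑' n : ZLat d, |F ((N:ℝ)⁻¹ • latVec n)| ^ p := tsum_nonneg fun n => by positivity
    have h2 := Real.rpow_le_rpow (by positivity) h1 hp0.le
    rw [Real.mul_rpow hM (by positivity), ← Real.rpow_mul hA, ← Real.rpow_mul hBn, one_div,
      inv_mul_cancel₀ hp0.ne', Real.rpow_one, Real.rpow_one,
      tsum_eq_flr_scale _ (N:ℝ) hN', tsum_eq_flr_scale _ (N:ℝ) hN'] at h2
    have hNd : (0:ℝ) < (N:ℝ) ^ d := by positivity
    refine le_of_mul_le_mul_left ?_ hNd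
    linarith
  have fat : ∫⁻ x : Eu d, ENNReal.ofReal (|RF x| ^ p) ≤ ENNReal.ofReal (M ^ p * ∫ x, |F x| ^ p) := by
    have e : ∀ x, ENNReal.ofReal (|RF x| ^ p) =
        liminf (fun N : ℕ => ENNReal.ofReal (|TN κ F N (flr ((N:ℝ) • x))| ^ p)) atTop := fun x =>
      ((ENNReal.tendsto_ofReal (hpt x)).liminf_eq).symm
    simp only [e]
    refine (lintegral_liminf_le fun N => (gm N).ennreal_ofReal).trans ?_
    have h2 := ENNReal.tendsto_ofReal ((F_lim hp hFc hB hρ).const_mul (M ^ p))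
    rw [← h2.liminf_eq]
    refine liminf_le_liminf ?_
    filter_upwards [eventually_ge_atTop 1] with N hN using bnd N hN
  have hFn : 0 ≤ ∫ x, |F x| ^ p := integral_nonneg fun x => by positivity
  have hRm : AEStronglyMeasurable (fun x => |RF x| ^ p) volume :=
    aestronglyMeasurable_of_tendsto_ae atTop (fun N => (gm N).aestronglyMeasurable) (Eventually.of_forall hpt)
  have hfin : ∫ x, |RF x| ^ p ≤ M ^ p * ∫ x, |F x| ^ p := by
    rw [integral_eq_lintegral_of_nonneg_ae (Eventually.of_forall fun x => by positivity) hRm]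
    exact ENNReal.toReal_le_of_le_ofReal (by positivity) fat
  have hRn : 0 ≤ ∫ x, |RF x| ^ p := integral_nonneg fun x => by positivity
  calc _ ≤ (M ^ p * ∫ x, |F x| ^ p) ^ (1 / p) := Real.rpow_le_rpow hRn hfin (by positivity)
    _ = _ := by
      rw [Real.mul_rpow (by positivity) hFn, ← Real.rpow_mul hM, mul_one_div, div_self hp0.ne', Real.rpow_one]

lemma KBound {d : ℕ} (c : ℝ) (q : ℝ) (y : Eu d) (hq : |q| ≤ ‖y‖ ^ 2) :
    |c * (q / ‖y‖ ^ (d + 2))| ≤ |c| * (‖y‖ ^ d)⁻¹ := by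
  rw [abs_mul]
  refine mul_le_mul_of_nonneg_left ?_ (abs_nonneg _)
  rw [abs_div, abs_of_nonneg (pow_nonneg (norm_nonneg y) (d + 2))]
  rcases eq_or_ne y 0 with rfl | hy
  · simp
  · have h : 0 < ‖y‖ := norm_pos_iff.2 hy
    rw [div_le_iff₀ (by positivity), pow_add, inv_mul_cancel_left₀ (by positivity)]
    exact hq

lemma comp_sq_add {d : ℕ} {j k : Fin d} (h : j ≠ k) (y : Eu d) : y j ^ 2 + y k ^ 2 ≤ ‖y‖ ^ 2 := by
  rw [EuclideanSpace.real_norm_sq_eq, ← Finset.sum_pair (f := fun i => y i ^ 2) h]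
  exact Finset.sum_le_sum_of_subset_of_nonneg (Finset.subset_univ _) fun _ _ _ => sq_nonneg _

theorem stmt16 (d : ℕ) (hd : 2 ≤ d) (p : ℝ) (hp : 1 < p) (j k : Fin d) (hjk : j ≠ k)
    (F : EuclideanSpace ℝ (Fin d) → ℝ) (hF : ContDiff ℝ (⊤ : ℕ∞) F) (hFc : HasCompactSupport F) :
    (∀ M : ℝ, 0 ≤ M →
      (∀ f : ZLat d → ℝ, MemLpLat d p f → lpN d p (Rprob d j k f) ≤ M * lpN d p f) →
      ∃ RF : EuclideanSpace ℝ (Fin d) → ℝ,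
        (∀ x : EuclideanSpace ℝ (Fin d),
          Filter.Tendsto (fun r : ℝ =>
              cConst d * ∫ y in {y : EuclideanSpace ℝ (Fin d) | r < ‖y‖},
                y j * y k / ‖y‖ ^ (d + 2) * F (x - y))
            (nhdsWithin 0 (Set.Ioi 0)) (nhds (RF x))) ∧
        (∫ x : EuclideanSpace ℝ (Fin d), |RF x| ^ p) ^ (1 / p) ≤
          M * (∫ x : EuclideanSpace ℝ (Fin d), |F x| ^ p) ^ (1 / p)) ∧
    (∀ M' : ℝ, 0 ≤ M' →
      (∀ f : ZLat d → ℝ, MemLpLat d p f →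
        lpN d p (fun n => Rprob d j j f n - Rprob d k k f n) ≤ M' * lpN d p f) →
      ∃ G : EuclideanSpace ℝ (Fin d) → ℝ,
        (∀ x : EuclideanSpace ℝ (Fin d),
          Filter.Tendsto (fun r : ℝ =>
              cConst d * ∫ y in {y : EuclideanSpace ℝ (Fin d) | r < ‖y‖},
                (y j ^ 2 - y k ^ 2) / ‖y‖ ^ (d + 2) * F (x - y))
            (nhdsWithin 0 (Set.Ioi 0)) (nhds (G x))) ∧
        (∫ x : EuclideanSpace ℝ (Fin d), |G x| ^ p) ^ (1 / p) ≤
          M' * (∫ x : EuclideanSpace ℝ (Fin d), |F x| ^ p) ^ (1 / p)) := by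
  have hd1 : 1 ≤ d := by omega
  have hp0 : p ≠ 0 := by linarith
  obtain ⟨ρ, hρ0⟩ := hFc.isCompact.isBounded.subset_closedBall 0
  have hρ : ∀ a, ρ < ‖a‖ → F a = 0 := by
    intro a ha
    by_contra h
    have := hρ0 (subset_tsupport F h)
    rw [mem_closedBall_zero_iff] at this
    linarith
  have hmem : ∀ N : ℝ, 0 < N → MemLpLat d p (fun m => F (N⁻¹ • latVec m)) := fun N hN =>
    fin_summable hN ρ _ fun m hm => by beta_reduce; rw [hρ _ hm, abs_zero, Real.zero_rpow hp0]
  obtain ⟨C, hC, hCb⟩ := probK_bound hd1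
  refine ⟨fun M hM hop => ?_, fun M hM hop => ?_⟩
  · obtain ⟨RF, h1, h2⟩ := transfer hd1 hp (reflE j) (reflZ j) (reflZ_vec j) hF hFc hC
      (κ := probK d j k) (probK_refl hjk) (hCb j k)
      (K := fun y => cConst d * (y j * y k / ‖y‖ ^ (d + 2))) (by fun_prop) (C' := |cConst d|)
      (fun y => KBound _ _ y (by
        have := comp_sq_add hjk y
        rw [abs_le]; constructor <;> nlinarith [sq_nonneg (y j + y k), sq_nonneg (y j - y k), sq_nonneg (y j), sq_nonneg (y k)]))
      (fun y => by
        simp only [LinearIsometryEquiv.norm_map, reflE_apply, hjk.symm, if_true, if_false]; ring)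
      (fun m y hy hm => K_lim1 hd1 hjk hy hm) hM (fun N hN => hop _ (hmem N hN))
    refine ⟨RF, fun x => ?_, h2⟩
    refine (h1 x).congr fun r => ?_
    rw [← integral_const_mul]
    simp only [mul_assoc]
  · obtain ⟨RF, h1, h2⟩ := transfer hd1 hp (swapE j k) (swapZ j k) (swapZ_vec j k) hF hFc (add_nonneg hC hC)
      (κ := fun m => probK d j j m - probK d k k m) probK_swap
      (fun m hm => by
        have a := hCb j j m hm
        have b := hCb k k m hm
        have c := mul_le_mul_of_nonneg_left (abs_sub (probK d j j m) (probK d k k m)) (pow_nonneg (norm_nonneg (latVec m)) d)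
        linarith)
      (K := fun y => cConst d * ((y j ^ 2 - y k ^ 2) / ‖y‖ ^ (d + 2))) (by fun_prop) (C' := |cConst d|)
      (fun y => KBound _ _ y (by
        have := comp_sq_add hjk y
        rw [abs_le]; constructor <;> nlinarith [sq_nonneg (y j), sq_nonneg (y k)]))
      (fun y => by
        simp only [LinearIsometryEquiv.norm_map, swapE_apply, Equiv.swap_apply_left, Equiv.swap_apply_right]; ring)
      (fun m y hy hm => K_lim2 hd1 hy hm) hM (fun N hN => by
        have e : TN (fun m => probK d j j m - probK d k k m) F N =
            fun n => Rprob d j j (fun m => F (N⁻¹ • latVec m)) n - Rprob d k k (fun m => F (N⁻¹ • latVec m)) n := by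
          funext n
          have s : ∀ i : Fin d, Summable fun m => probK d i i (n - m) * F (N⁻¹ • latVec m) := fun i =>
            fin_summable hN ρ _ fun m hm => by rw [hρ _ hm, mul_zero]
          simp only [TN, Rprob]
          rw [← (s j).tsum_sub (s k)]
          simp only [sub_mul]
        rw [e]
        exact hop _ (hmem N hN))
    refine ⟨RF, fun x => ?_, h2⟩
    refine (h1 x).congr fun r => ?_
    rw [← integral_const_mul]
    simp only [mul_assoc]

end
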